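/- arXiv:math/9812123 — 2 statements merged into one kernel-verified Lean document; each statement's English description precedes it below -/
import Mathlib

section
/- Let 1 ≤ j < k < n be integers. Then f(0,k−j,n) / f(j,k,n) < √(2/π) · (j(k−j)/(n−k+j))^{1/2} · ∫_0^∞ exp(−(j(k−j)/(n−k+j)) · t²/2) · (√(2/π) ∫_0^t e^{-x²/2} dx)^j dt. -/
open MeasureTheory Filter Real

noncomputable section

/-- The orthogonal group O(n) of ℝⁿ. -/
abbrev OG (n : ℕ) : Type := Matrix.orthogonalGroup (Fin n) ℝ

instance (n : ℕ) : MeasurableSpace (OG n) := borel _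
instance (n : ℕ) : BorelSpace (OG n) := ⟨rfl⟩

/-- The natural action of `g ∈ O(n)` on `ℝⁿ`. -/
def act {n : ℕ} (g : OG n) (x : EuclideanSpace ℝ (Fin n)) : EuclideanSpace ℝ (Fin n) :=
  Matrix.toEuclideanLin (g : Matrix (Fin n) (Fin n) ℝ) x

/-- `E_k`: the span of the first `k` standard basis vectors of `ℝⁿ`, as a set. -/
def Ek (n k : ℕ) : Set (EuclideanSpace ℝ (Fin n)) :=
  {x | ∀ i : Fin n, k ≤ (i : ℕ) → x i = 0}

/-- The `m`-dimensional face `{x : |xᵢ| ≤ 1 for i < m, xᵢ = 1 for i ≥ m}` of the cube `[-1,1]ⁿ`. -/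
def cubeFace (n m : ℕ) : Set (EuclideanSpace ℝ (Fin n)) :=
  {x | (∀ i : Fin n, (i : ℕ) < m → |x i| ≤ 1) ∧ ∀ i : Fin n, m ≤ (i : ℕ) → x i = 1}

/-- `f(j,k,n)`, the expected number of `j`-faces of a random `k`-section of the `n`-cube,
computed with respect to the probability measure `H` on `O(n)`. -/
def expFaces (n : ℕ) (H : Measure (OG n)) (j k : ℕ) : ℝ :=
  2 ^ (k - j) * (n.choose (k - j)) *
    (H {g | (act g '' Ek n k ∩ cubeFace n (n - k + j)).Nonempty}).toReal

lemma pi_gaussian_density (j : ℕ) :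
    Measure.pi (fun _ : Fin j => ProbabilityTheory.gaussianReal 0 1) =
      (volume : Measure (Fin j → ℝ)).withDensity
        (fun x => ENNReal.ofReal (∏ i, ProbabilityTheory.gaussianPDFReal 0 1 (x i))) := by
  refine Measure.pi_eq (fun s hs => ?_)
  rw [withDensity_apply _ (MeasurableSet.univ_pi hs)]
  have hi : ∀ i, Integrable (Set.indicator (s i) (ProbabilityTheory.gaussianPDFReal 0 1)) volume :=
    fun i => (ProbabilityTheory.integrable_gaussianPDFReal 0 1).indicator (hs i)
  have hp := Integrable.fintype_prod (f := fun i : Fin j => Set.indicator (s i) (ProbabilityTheory.gaussianPDFReal 0 1)) (μ := fun _ => volume) hi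
  have hnn : ∀ i x, 0 ≤ Set.indicator (s i) (ProbabilityTheory.gaussianPDFReal 0 1) x := by
    intro i x
    exact Set.indicator_nonneg (fun x _ => ProbabilityTheory.gaussianPDFReal_nonneg 0 1 x) x
  have h1 : ∫⁻ a : Fin j → ℝ in Set.univ.pi s, ENNReal.ofReal (∏ i, ProbabilityTheory.gaussianPDFReal 0 1 (a i))
      = ∫⁻ a : Fin j → ℝ, ENNReal.ofReal (∏ i, Set.indicator (s i) (ProbabilityTheory.gaussianPDFReal 0 1) (a i)) := by
    rw [← lintegral_indicator (MeasurableSet.univ_pi hs)]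
    congr 1
    ext a
    by_cases ha : a ∈ Set.univ.pi s
    · rw [Set.indicator_of_mem ha]
      congr 1
      refine Finset.prod_congr rfl (fun i _ => ?_)
      rw [Set.indicator_of_mem (ha i (Set.mem_univ i))]
    · rw [Set.indicator_of_notMem ha]
      have : ∃ i, a i ∉ s i := by
        by_contra hcon
        push Not at hcon
        exact ha (fun i _ => hcon i)
      obtain ⟨i, hi⟩ := this
      rw [Finset.prod_eq_zero (Finset.mem_univ i) (Set.indicator_of_notMem hi _)]
      simp
  rw [h1, volume_pi, ← ofReal_integral_eq_lintegral_ofReal hp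
    (Filter.Eventually.of_forall fun x => Finset.prod_nonneg fun i _ => hnn i _)]
  have := integral_fintype_prod_eq_prod (μ := fun _ : Fin j => (volume : Measure ℝ)) (fun (i : Fin j) => Set.indicator (s i) (ProbabilityTheory.gaussianPDFReal 0 1))
  rw [this, ENNReal.ofReal_prod_of_nonneg (fun i _ => integral_nonneg (hnn i))]
  refine Finset.prod_congr rfl (fun i _ => ?_)
  rw [integral_indicator (hs i), ProbabilityTheory.gaussianReal_apply_eq_integral _ one_ne_zero]

/-- standard Gaussian density on Euclidean space -/
def gphi (j : ℕ) (y : EuclideanSpace ℝ (Fin j)) : ℝ :=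
  (√(2 * π))⁻¹ ^ j * Real.exp (-‖y‖ ^ 2 / 2)

lemma gphi_pos (j : ℕ) (y : EuclideanSpace ℝ (Fin j)) : 0 < gphi j y := by
  unfold gphi; positivity

lemma stdGaussian_density (j : ℕ) (s : Set (EuclideanSpace ℝ (Fin j))) (hs : MeasurableSet s) :
    ProbabilityTheory.stdGaussian (EuclideanSpace ℝ (Fin j)) s =
      ∫⁻ y in s, ENNReal.ofReal (gphi j y) := by
  rw [← ProbabilityTheory.map_pi_eq_stdGaussian, Measure.map_apply (by fun_prop) hs, pi_gaussian_density,
    withDensity_apply _ ((by fun_prop : Measurable (WithLp.toLp 2 : (Fin j → ℝ) → _)) hs)]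
  have := (EuclideanSpace.volume_preserving_symm_measurableEquiv_toLp (Fin j)).symm
  rw [← (this.setLIntegral_comp_preimage_emb (MeasurableEquiv.measurableEmbedding _) _ s)]
  refine setLIntegral_congr_fun ((by fun_prop : Measurable (WithLp.toLp 2 : (Fin j → ℝ) → _)) hs) (fun x _ => ?_)
  congr 1
  simp [gphi, ProbabilityTheory.gaussianPDFReal, Finset.prod_mul_distrib, EuclideanSpace.norm_sq_eq, ← Real.exp_sum, Finset.sum_div, neg_div]

lemma lintegral_gphi (j : ℕ) : ∫⁻ y, ENNReal.ofReal (gphi j y) = 1 := by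
  have := stdGaussian_density j Set.univ MeasurableSet.univ
  simpa using this.symm

/-- one-dimensional standard normal density -/
abbrev nph : ℝ → ℝ := ProbabilityTheory.gaussianPDFReal 0 1
/-- one-dimensional standard normal measure -/
abbrev ngm : Measure ℝ := ProbabilityTheory.gaussianReal 0 1

/-- standard normal CDF -/
def nPhi (x : ℝ) : ℝ := ProbabilityTheory.cdf ngm x

lemma nph_pos (x : ℝ) : 0 < nph x := ProbabilityTheory.gaussianPDFReal_pos 0 1 x one_ne_zero

lemma nph_eq (x : ℝ) : nph x = (√(2 * π))⁻¹ * Real.exp (-x ^ 2 / 2) := by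
  simp [nph, ProbabilityTheory.gaussianPDFReal]

lemma nph_cont : Continuous nph := by
  have : nph = fun x => (√(2 * π))⁻¹ * Real.exp (-x ^ 2 / 2) := funext nph_eq
  rw [this]; fun_prop

lemma nPhi_sub (x y : ℝ) : nPhi y - nPhi x = ∫ t in x..y, nph t := by
  have h (z : ℝ) : nPhi z = ∫ t in Set.Iic z, nph t := by
    rw [nPhi, ProbabilityTheory.cdf_eq_real, Measure.real, ProbabilityTheory.gaussianReal_apply_eq_integral _ one_ne_zero,
      ENNReal.toReal_ofReal (integral_nonneg fun x => (nph_pos x).le)]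
  have hi := ProbabilityTheory.integrable_gaussianPDFReal 0 1
  rw [h, h, intervalIntegral.integral_Iic_sub_Iic hi.integrableOn hi.integrableOn]

lemma nPhi_hasDerivAt (x : ℝ) : HasDerivAt nPhi (nph x) x := by
  have h : nPhi = fun y => nPhi 0 + ∫ t in (0:ℝ)..y, nph t := by
    ext y; rw [← nPhi_sub]; ring
  rw [h]
  exact (intervalIntegral.integral_hasDerivAt_right (nph_cont.intervalIntegrable _ _)
    (nph_cont.stronglyMeasurableAtFilter _ _) nph_cont.continuousAt).const_add _

lemma nPhi_strictMono : StrictMono nPhi :=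
  strictMono_of_hasDerivAt_pos nPhi_hasDerivAt nph_pos

lemma nPhi_cont : Continuous nPhi :=
  continuous_iff_continuousAt.2 fun x => (nPhi_hasDerivAt x).continuousAt

lemma nPhi_surj {y : ℝ} (h : y ∈ Set.Ioo (0:ℝ) 1) : ∃ x, nPhi x = y := by
  have h0 : Tendsto nPhi atBot (nhds 0) := ProbabilityTheory.tendsto_cdf_atBot ngm
  have h1 : Tendsto nPhi atTop (nhds 1) := ProbabilityTheory.tendsto_cdf_atTop ngm
  obtain ⟨a, ha⟩ := (h0.eventually (gt_mem_nhds h.1)).exists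
  obtain ⟨b, hb⟩ := (h1.eventually (lt_mem_nhds h.2)).exists
  exact mem_range_of_exists_le_of_exists_ge nPhi_cont ⟨a, ha.le⟩ ⟨b, hb.le⟩

lemma nPhi_mem (x : ℝ) : nPhi x ∈ Set.Ioo (0:ℝ) 1 := by
  constructor
  · exact (ProbabilityTheory.cdf_nonneg ngm (x-1)).trans_lt (nPhi_strictMono (by linarith))
  · exact (nPhi_strictMono (by linarith : x < x + 1)).trans_le (ProbabilityTheory.cdf_le_one ngm (x+1))

/-- inverse normal CDF -/
def nPsi : ℝ → ℝ := Function.invFun nPhi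

lemma nPsi_nPhi (x : ℝ) : nPsi (nPhi x) = x :=
  Function.leftInverse_invFun nPhi_strictMono.injective x

lemma nPhi_nPsi {y : ℝ} (h : y ∈ Set.Ioo (0:ℝ) 1) : nPhi (nPsi y) = y :=
  Function.invFun_eq (nPhi_surj h)

lemma nPsi_strictMonoOn : StrictMonoOn nPsi (Set.Ioo 0 1) := by
  intro a ha b hb hab
  rw [← nPhi_strictMono.lt_iff_lt, nPhi_nPsi ha, nPhi_nPsi hb]
  exact hab

lemma nPsi_hasDerivAt {y : ℝ} (h : y ∈ Set.Ioo (0:ℝ) 1) :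
    HasDerivAt nPsi (nph (nPsi y))⁻¹ y := by
  have hn : Set.Ioo (0:ℝ) 1 ∈ nhds y := isOpen_Ioo.mem_nhds h
  refine HasDerivAt.of_local_left_inverse ?_ (nPhi_hasDerivAt _) (nph_pos _).ne' ?_
  · refine continuousAt_of_monotoneOn_of_image_mem_nhds nPsi_strictMonoOn.monotoneOn hn ?_
    have : nPsi '' Set.Ioo 0 1 = Set.univ := by
      refine Set.eq_univ_of_forall fun x => ⟨nPhi x, nPhi_mem x, nPsi_nPhi x⟩
    rw [this]; exact Filter.univ_mem
  · filter_upwards [hn] with z hz using nPhi_nPsi hz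

lemma ngm_Ioo {l r : ℝ} (h : l ≤ r) : ngm.real (Set.Ioo l r) = nPhi r - nPhi l := by
  rw [nPhi_sub, Measure.real, ProbabilityTheory.gaussianReal_apply_eq_integral _ one_ne_zero,
      ENNReal.toReal_ofReal (integral_nonneg fun x => (nph_pos x).le),
      intervalIntegral.integral_of_le h, integral_Ioc_eq_integral_Ioo]

lemma transport {l r : ℝ} (h : l < r) : ∃ T T' : ℝ → ℝ, StrictMonoOn T (Set.Ioo l r) ∧
    ∀ u ∈ Set.Ioo l r, HasDerivAt T (T' u) u ∧ 0 < T' u ∧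
      nph u = ngm.real (Set.Ioo l r) * nph (T u) * T' u := by
  set I := ngm.real (Set.Ioo l r) with hI
  have hI' : I = nPhi r - nPhi l := ngm_Ioo h.le
  have hIpos : 0 < I := by rw [hI']; exact sub_pos.2 (nPhi_strictMono h)
  have hmem : ∀ u ∈ Set.Ioo l r, (nPhi u - nPhi l) / I ∈ Set.Ioo (0:ℝ) 1 := by
    intro u hu
    have h1 := nPhi_strictMono hu.1
    have h2 := nPhi_strictMono hu.2
    refine ⟨div_pos (by linarith) hIpos, (div_lt_one hIpos).2 (by linarith)⟩
  refine ⟨fun u => nPsi ((nPhi u - nPhi l) / I),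
    fun u => (nph (nPsi ((nPhi u - nPhi l) / I)))⁻¹ * (nph u / I), ?_, ?_⟩
  · intro a ha b hb hab
    refine nPsi_strictMonoOn (hmem a ha) (hmem b hb) ?_
    have := nPhi_strictMono hab
    gcongr
  · intro u hu
    refine ⟨?_, ?_, ?_⟩
    · exact (nPsi_hasDerivAt (hmem u hu)).comp u (((nPhi_hasDerivAt u).sub_const _).div_const _)
    · have := nph_pos (nPsi ((nPhi u - nPhi l) / I))
      have := nph_pos u
      positivity
    · have := (nph_pos (nPsi ((nPhi u - nPhi l) / I))).ne'
      field_simp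

section BL
section BL

variable {ι : Type*} [Fintype ι] {j : ℕ}

lemma sum_c_eq (u : ι → EuclideanSpace ℝ (Fin j)) (c : ι → ℝ)
    (hu : ∀ i, ‖u i‖ = 1)
    (hsum : ∀ x y : EuclideanSpace ℝ (Fin j), ∑ i, c i * (inner ℝ (u i) x * inner ℝ (u i) y) = inner ℝ x y) :
    ∑ i, c i = j := by
  have hb := EuclideanSpace.basisFun (Fin j) ℝ
  have h1 : ∀ i, ∑ l, inner ℝ (u i) (hb l) * inner ℝ (u i) (hb l) = 1 := by
    intro i
    have := hb.sum_inner_mul_inner (u i) (u i)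
    rw [real_inner_self_eq_norm_sq, hu i] at this
    refine Eq.trans ?_ (this.trans (one_pow 2))
    refine Finset.sum_congr rfl fun l _ => ?_
    rw [real_inner_comm (u i) (hb l)]
  calc ∑ i, c i = ∑ i, c i * ∑ l, inner ℝ (u i) (hb l) * inner ℝ (u i) (hb l) := by simp [h1]
    _ = ∑ l, ∑ i, c i * (inner ℝ (u i) (hb l) * inner ℝ (u i) (hb l)) := by
        simp_rw [Finset.mul_sum]; rw [Finset.sum_comm]
    _ = ∑ l : Fin j, 1 := by
        refine Finset.sum_congr rfl fun l _ => ?_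
        rw [hsum, real_inner_self_eq_norm_sq, hb.norm_eq_one]; norm_num
    _ = j := by simp

/-- the linear map `Σ cᵢ tᵢ uᵢ ⊗ uᵢ` -/
def blMap (u : ι → EuclideanSpace ℝ (Fin j)) (a : ι → ℝ) :
    EuclideanSpace ℝ (Fin j) →L[ℝ] EuclideanSpace ℝ (Fin j) :=
  ∑ i, a i • (innerSL ℝ (u i)).smulRight (u i)

lemma blMap_apply (u : ι → EuclideanSpace ℝ (Fin j)) (a : ι → ℝ) (x : EuclideanSpace ℝ (Fin j)) :
    blMap u a x = ∑ i, a i • (inner ℝ (u i) x : ℝ) • u i := by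
  simp [blMap]

lemma det_ineq (u : ι → EuclideanSpace ℝ (Fin j)) (c : ι → ℝ) (t : ι → ℝ)
    (hu : ∀ i, ‖u i‖ = 1) (hc : ∀ i, 0 < c i) (ht : ∀ i, 0 < t i)
    (hsum : ∀ x y : EuclideanSpace ℝ (Fin j), ∑ i, c i * (inner ℝ (u i) x * inner ℝ (u i) y) = inner ℝ x y) :
    ∏ i, t i ^ c i ≤ (blMap u (fun i => c i * t i)).det := by
  set M := blMap u (fun i => c i * t i) with hM
  have hinner : ∀ x y, inner ℝ (M x) y = ∑ i, c i * t i * (inner ℝ (u i) x * inner ℝ (u i) y) := by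
    intro x y
    rw [hM, blMap_apply, sum_inner]
    refine Finset.sum_congr rfl fun i _ => ?_
    rw [real_inner_smul_left, real_inner_smul_left]
  have hsym : (M : EuclideanSpace ℝ (Fin j) →ₗ[ℝ] EuclideanSpace ℝ (Fin j)).IsSymmetric := by
    intro x y
    rw [real_inner_comm]
    simp only [ContinuousLinearMap.coe_coe]
    rw [real_inner_comm, hinner, real_inner_comm, hinner]
    refine Finset.sum_congr rfl fun i _ => ?_
    ring
  have hn : Module.finrank ℝ (EuclideanSpace ℝ (Fin j)) = j := by simp
  have hdet : M.det = ∏ l, hsym.eigenvalues hn l := by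
    have := hsym.det_eq_prod_eigenvalues hn
    simpa using this
  set e := hsym.eigenvectorBasis hn with he
  have hlam : ∀ l, hsym.eigenvalues hn l = ∑ i, c i * inner ℝ (u i) (e l) ^ 2 * t i := by
    intro l
    have h1 := hsym.apply_eigenvectorBasis hn l
    have h2 : inner ℝ (M (e l)) (e l) = hsym.eigenvalues hn l := by
      have h1' : M (e l) = (hsym.eigenvalues hn l : ℝ) • e l := h1
      rw [h1', real_inner_smul_left, real_inner_self_eq_norm_sq, e.norm_eq_one]; norm_num
    rw [← h2, hinner]
    refine Finset.sum_congr rfl fun i _ => ?_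
    ring
  have hw1 : ∀ l, ∑ i, c i * inner ℝ (u i) (e l) ^ 2 = 1 := by
    intro l
    have := hsum (e l) (e l)
    rw [real_inner_self_eq_norm_sq, e.norm_eq_one] at this
    refine Eq.trans ?_ (this.trans (one_pow 2))
    refine Finset.sum_congr rfl fun i _ => ?_
    ring
  have hu1 : ∀ i, ∑ l, inner ℝ (u i) (e l) ^ 2 = 1 := by
    intro i
    have := e.sum_inner_mul_inner (u i) (u i)
    rw [real_inner_self_eq_norm_sq, hu i] at this
    refine Eq.trans ?_ (this.trans (one_pow 2))
    refine Finset.sum_congr rfl fun l _ => ?_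
    rw [real_inner_comm (u i) (e l)]; ring
  have hge : ∀ l, ∏ i, t i ^ (c i * inner ℝ (u i) (e l) ^ 2) ≤ hsym.eigenvalues hn l := by
    intro l
    rw [hlam]
    exact Real.geom_mean_le_arith_mean_weighted Finset.univ _ t
      (fun i _ => mul_nonneg (hc i).le (sq_nonneg _)) (hw1 l) (fun i _ => (ht i).le)
  rw [hdet]
  refine le_trans (le_of_eq ?_) (Finset.prod_le_prod (fun l _ => Finset.prod_nonneg fun i _ => Real.rpow_nonneg (ht i).le _) (fun l _ => hge l))
  rw [Finset.prod_comm]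
  refine Finset.prod_congr rfl fun i _ => ?_
  rw [← Real.rpow_sum_of_pos (ht i), ← Finset.mul_sum, hu1, mul_one]

lemma norm_sq_le (u : ι → EuclideanSpace ℝ (Fin j)) (c : ι → ℝ) (t : ι → ℝ)
    (hc : ∀ i, 0 < c i)
    (hsum : ∀ x y : EuclideanSpace ℝ (Fin j), ∑ i, c i * (inner ℝ (u i) x * inner ℝ (u i) y) = inner ℝ x y) :
    ‖∑ i, (c i * t i) • u i‖ ^ 2 ≤ ∑ i, c i * t i ^ 2 := by
  set w := ∑ i, (c i * t i) • u i with hw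
  have h1 : ‖w‖ ^ 2 = ∑ i, c i * t i * inner ℝ (u i) w := by
    rw [← real_inner_self_eq_norm_sq]
    nth_rewrite 1 [hw]
    rw [sum_inner]
    refine Finset.sum_congr rfl fun i _ => ?_
    rw [real_inner_smul_left]
  have h2 : ‖w‖ ^ 2 = ∑ i, c i * (inner ℝ (u i) w * inner ℝ (u i) w) := by
    rw [hsum, real_inner_self_eq_norm_sq]
  have h3 : ∑ i, c i * t i * inner ℝ (u i) w ≤ ∑ i, (c i * t i ^ 2 + c i * (inner ℝ (u i) w * inner ℝ (u i) w)) / 2 := by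
    refine Finset.sum_le_sum fun i _ => ?_
    nlinarith [mul_nonneg (hc i).le (sq_nonneg (t i - inner ℝ (u i) w))]
  rw [← Finset.sum_div, Finset.sum_add_distrib, ← h1, ← h2] at h3
  linarith

theorem brascamp_lieb (u : ι → EuclideanSpace ℝ (Fin j)) (c : ι → ℝ)
    (hu : ∀ i, ‖u i‖ = 1) (hc : ∀ i, 0 < c i)
    (hsum : ∀ x y : EuclideanSpace ℝ (Fin j), ∑ i, c i * (inner ℝ (u i) x * inner ℝ (u i) y) = inner ℝ x y)
    (l r : ι → ℝ) (hlr : ∀ i, l i < r i) :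
    ProbabilityTheory.stdGaussian (EuclideanSpace ℝ (Fin j))
      {y | ∀ i, inner ℝ (u i) y ∈ Set.Ioo (l i) (r i)} ≤
      ENNReal.ofReal (∏ i, (ngm.real (Set.Ioo (l i) (r i))) ^ c i) := by
  choose T T' hT hT' using fun i => transport (hlr i)
  set P : Set (EuclideanSpace ℝ (Fin j)) := {y | ∀ i, inner ℝ (u i) y ∈ Set.Ioo (l i) (r i)} with hP
  have hPm : MeasurableSet P := by
    have : P = ⋂ i, (fun y => (inner ℝ (u i) y : ℝ)) ⁻¹' Set.Ioo (l i) (r i) := by ext; simp [hP]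
    rw [this]
    exact MeasurableSet.iInter fun i => measurableSet_Ioo.preimage (by fun_prop)
  set I : ι → ℝ := fun i => ngm.real (Set.Ioo (l i) (r i)) with hI
  have hIpos : ∀ i, 0 < I i := fun i => by
    simp only [hI]; rw [ngm_Ioo (hlr i).le]; exact sub_pos.2 (nPhi_strictMono (hlr i))
  set Θ : EuclideanSpace ℝ (Fin j) → EuclideanSpace ℝ (Fin j) :=
    fun y => ∑ i, (c i * T i (inner ℝ (u i) y)) • u i with hΘ
  set Θ' : EuclideanSpace ℝ (Fin j) → EuclideanSpace ℝ (Fin j) →L[ℝ] EuclideanSpace ℝ (Fin j) :=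
    fun y => blMap u (fun i => c i * T' i (inner ℝ (u i) y)) with hΘ'
  have hder : ∀ y ∈ P, HasFDerivWithinAt Θ (Θ' y) P y := by
    intro y hy
    apply HasFDerivAt.hasFDerivWithinAt
    simp only [hΘ, hΘ', blMap]
    refine HasFDerivAt.fun_sum fun i _ => ?_
    have h1 : HasFDerivAt (fun y : EuclideanSpace ℝ (Fin j) => (inner ℝ (u i) y : ℝ)) (innerSL ℝ (u i)) y :=
      (innerSL ℝ (u i)).hasFDerivAt
    have h2 := ((hT' i _ (hy i)).1.comp_hasFDerivAt y h1).const_mul (c i)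
    have h3 := h2.smul_const (u i)
    refine h3.congr_fderiv ?_
    ext x
    simp [mul_assoc]
  have hinj : Set.InjOn Θ P := by
    intro y hy z hz hyz
    by_contra hne
    have h1 : ∑ i, c i * ((T i (inner ℝ (u i) y) - T i (inner ℝ (u i) z)) * (inner ℝ (u i) y - inner ℝ (u i) z)) = 0 := by
      have h0 : inner ℝ (Θ y - Θ z) (y - z) = 0 := by rw [hyz, sub_self, inner_zero_left]
      rw [← h0]
      simp only [hΘ]
      rw [← Finset.sum_sub_distrib, sum_inner]
      refine Finset.sum_congr rfl fun i _ => ?_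
      rw [← sub_smul, real_inner_smul_left, inner_sub_right]
      ring
    have hnn : ∀ i, 0 ≤ (T i (inner ℝ (u i) y) - T i (inner ℝ (u i) z)) * (inner ℝ (u i) y - inner ℝ (u i) z) := by
      intro i
      rcases le_total (inner ℝ (u i) y : ℝ) (inner ℝ (u i) z) with h | h
      · have := (hT i).monotoneOn (hy i) (hz i) h
        nlinarith
      · have := (hT i).monotoneOn (hz i) (hy i) h
        nlinarith
    rw [Finset.sum_eq_zero_iff_of_nonneg (fun i _ => mul_nonneg (hc i).le (hnn i))] at h1
    have heq : ∀ i, (inner ℝ (u i) (y - z) : ℝ) = 0 := by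
      intro i
      have := h1 i (Finset.mem_univ i)
      rw [mul_eq_zero, or_iff_right (hc i).ne', mul_eq_zero] at this
      rw [inner_sub_right]
      rcases this with h | h
      · rw [sub_eq_zero] at h ⊢
        exact (hT i).injOn (hy i) (hz i) h
      · exact h
    have := hsum (y - z) (y - z)
    simp only [heq, mul_zero, Finset.sum_const_zero] at this
    exact hne (sub_eq_zero.1 (inner_self_eq_zero.1 this.symm))
  have hsc := sum_c_eq u c hu hsum
  have key : ∀ y ∈ P, gphi j y ≤ (∏ i, I i ^ c i) * ((Θ' y).det * gphi j (Θ y)) := by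
    intro y hy
    have hdet := det_ineq u c (fun i => T' i (inner ℝ (u i) y)) hu hc (fun i => (hT' i _ (hy i)).2.1) hsum
    have hnorm := norm_sq_le u c (fun i => T i (inner ℝ (u i) y)) hc hsum
    have hprodnph : ∀ s : ι → ℝ, ∏ i, nph (s i) ^ c i = (√(2 * π))⁻¹ ^ j * Real.exp (-(∑ i, c i * s i ^ 2) / 2) := by
      intro s
      have : ∀ i, nph (s i) ^ c i = (√(2 * π))⁻¹ ^ (c i) * Real.exp (- (c i * s i ^ 2) / 2) := by
        intro i
        rw [nph_eq, Real.mul_rpow (by positivity) (by positivity), ← Real.exp_mul]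
        congr 2; ring
      simp_rw [this]
      rw [Finset.prod_mul_distrib, ← Real.rpow_sum_of_pos (by positivity), hsc, Real.rpow_natCast, ← Real.exp_sum,
        ← Finset.sum_div, Finset.sum_neg_distrib]
    have h1 : gphi j y = ∏ i, nph (inner ℝ (u i) y) ^ c i := by
      rw [hprodnph, gphi, ← real_inner_self_eq_norm_sq, ← hsum]
      congr 4
      refine Finset.sum_congr rfl fun i _ => ?_
      ring
    have h2 : ∏ i, nph (inner ℝ (u i) y) ^ c i =
        (∏ i, I i ^ c i) * ((∏ i, nph (T i (inner ℝ (u i) y)) ^ c i) * ∏ i, T' i (inner ℝ (u i) y) ^ c i) := by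
      rw [← Finset.prod_mul_distrib, ← Finset.prod_mul_distrib]
      refine Finset.prod_congr rfl fun i _ => ?_
      obtain ⟨_, hp, he⟩ := hT' i _ (hy i)
      rw [he, Real.mul_rpow (mul_nonneg (hIpos i).le (nph_pos _).le) hp.le, Real.mul_rpow (hIpos i).le (nph_pos _).le, mul_assoc]
    have h3 : ∏ i, nph (T i (inner ℝ (u i) y)) ^ c i ≤ gphi j (Θ y) := by
      rw [hprodnph, gphi]
      gcongr
    rw [h1, h2]
    refine mul_le_mul_of_nonneg_left ?_ (Finset.prod_nonneg fun i _ => Real.rpow_nonneg (hIpos i).le _)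
    rw [mul_comm]
    refine mul_le_mul hdet h3 (Finset.prod_nonneg fun i _ => Real.rpow_nonneg (nph_pos _).le _) ?_
    exact le_trans (Finset.prod_nonneg fun i _ => Real.rpow_nonneg (hT' i _ (hy i)).2.1.le _) hdet
  rw [stdGaussian_density j P hPm]
  have hC : 0 ≤ ∏ i, I i ^ c i := Finset.prod_nonneg fun i _ => Real.rpow_nonneg (hIpos i).le _
  calc ∫⁻ y in P, ENNReal.ofReal (gphi j y)
      ≤ ∫⁻ y in P, ENNReal.ofReal (∏ i, I i ^ c i) * (ENNReal.ofReal |(Θ' y).det| * ENNReal.ofReal (gphi j (Θ y))) := by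
        refine setLIntegral_mono' hPm fun y hy => ?_
        rw [← ENNReal.ofReal_mul (abs_nonneg _), ← ENNReal.ofReal_mul hC]
        refine ENNReal.ofReal_le_ofReal ((key y hy).trans ?_)
        refine mul_le_mul_of_nonneg_left ?_ hC
        exact mul_le_mul_of_nonneg_right (le_abs_self _) (gphi_pos _ _).le
    _ = ENNReal.ofReal (∏ i, I i ^ c i) * ∫⁻ y in P, (ENNReal.ofReal |(Θ' y).det| * ENNReal.ofReal (gphi j (Θ y))) :=
        lintegral_const_mul' _ _ ENNReal.ofReal_ne_top
    _ = ENNReal.ofReal (∏ i, I i ^ c i) * ∫⁻ y in Θ '' P, ENNReal.ofReal (gphi j y) := by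
        rw [lintegral_image_eq_lintegral_abs_det_fderiv_mul volume hPm hder hinj]
    _ ≤ ENNReal.ofReal (∏ i, I i ^ c i) * 1 := by
        gcongr
        rw [← lintegral_gphi j]
        exact setLIntegral_le_lintegral _ _
    _ = _ := mul_one _

end BL

end BL

/-- `P(|X| ≤ t)` for a standard normal -/
def nE (t : ℝ) : ℝ := Real.sqrt (2 / π) * ∫ x in (0 : ℝ)..t, Real.exp (-x ^ 2 / 2)

lemma two_nph (x : ℝ) : 2 * nph x = Real.sqrt (2 / π) * Real.exp (-x ^ 2 / 2) := by
  rw [nph_eq, ← mul_assoc]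
  congr 1
  rw [Real.sqrt_div (by norm_num), Real.sqrt_mul (by norm_num)]
  have h2 : √2 * √2 = 2 := Real.mul_self_sqrt (by norm_num)
  have : √2 ≠ 0 := by positivity
  have : √π ≠ 0 := by positivity
  field_simp
  linarith

lemma nE_eq (t : ℝ) : nE t = 2 * ∫ x in (0:ℝ)..t, nph x := by
  rw [nE, ← intervalIntegral.integral_const_mul, ← intervalIntegral.integral_const_mul]
  congr 1; ext x; rw [two_nph]

lemma nph_neg (x : ℝ) : nph (-x) = nph x := by rw [nph_eq, nph_eq]; simp

lemma nPhi_sub_neg (a b : ℝ) : nPhi (-a) - nPhi (-b) = nPhi b - nPhi a := by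
  rw [nPhi_sub, nPhi_sub]
  have := intervalIntegral.integral_comp_neg (a := a) (b := b) (fun x => nph x)
  rw [← this]
  simp [nph_neg]

lemma nE_eq' (t : ℝ) : nE t = nPhi t - nPhi (-t) := by
  rw [nE_eq, ← nPhi_sub]
  have := nPhi_sub_neg 0 t
  simp at this
  linarith

lemma nE_hasDerivAt (t : ℝ) : HasDerivAt nE (2 * nph t) t := by
  have : nE = fun t => 2 * (nPhi t - nPhi 0) := by
    ext t; rw [nE_eq, nPhi_sub]
  rw [this]
  exact ((nPhi_hasDerivAt t).sub_const _).const_mul 2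

lemma nE_strictMono : StrictMono nE :=
  strictMono_of_hasDerivAt_pos nE_hasDerivAt fun x => by have := nph_pos x; positivity

lemma nE_cont : Continuous nE :=
  continuous_iff_continuousAt.2 fun x => (nE_hasDerivAt x).continuousAt

lemma nE_zero : nE 0 = 0 := by simp [nE]

lemma nE_nonneg {t : ℝ} (h : 0 ≤ t) : 0 ≤ nE t := by
  rw [← nE_zero]; exact nE_strictMono.monotone h

lemma nE_le_one (t : ℝ) : nE t ≤ 1 := by
  rw [nE_eq']; have := nPhi_mem t; have := nPhi_mem (-t)
  simp only [Set.mem_Ioo] at *; linarith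

lemma anderson_aux {s r : ℝ} (hs : 0 ≤ s) (hr : 0 ≤ r) : nPhi (s + r) - nPhi (s - r) ≤ nE r := by
  have h1 : nPhi (s + r) - nPhi r = ∫ x in (0:ℝ)..s, nph (x + r) := by
    rw [intervalIntegral.integral_comp_add_right, nPhi_sub]; simp
  have h2 : nPhi (s - r) - nPhi (-r) = ∫ x in (0:ℝ)..s, nph (x - r) := by
    rw [intervalIntegral.integral_comp_sub_right, nPhi_sub]; simp
  have h3 : ∫ x in (0:ℝ)..s, nph (x + r) ≤ ∫ x in (0:ℝ)..s, nph (x - r) := by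
    refine intervalIntegral.integral_mono_on hs ?_ ?_ ?_
    · exact (nph_cont.comp (by fun_prop : Continuous fun x : ℝ => x + r)).intervalIntegrable _ _
    · exact (nph_cont.comp (by fun_prop : Continuous fun x : ℝ => x - r)).intervalIntegrable _ _
    · intro x hx
      rw [nph_eq, nph_eq]
      refine mul_le_mul_of_nonneg_left (Real.exp_le_exp.2 ?_) (by positivity)
      nlinarith [hx.1, mul_nonneg hx.1 hr]
  rw [nE_eq']
  linarith

lemma anderson (s : ℝ) {r : ℝ} (hr : 0 ≤ r) : nPhi (s + r) - nPhi (s - r) ≤ nE r := by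
  rcases le_total 0 s with h | h
  · exact anderson_aux h hr
  · have := anderson_aux (neg_nonneg.2 h) hr
    have h2 := nPhi_sub_neg (s - r) (s + r)
    have e1 : -(s - r) = -s + r := by ring
    have e2 : -(s + r) = -s - r := by ring
    rw [e1, e2] at h2
    linarith

lemma nE_sqrt_concave : ConcaveOn ℝ (Set.Ici 0) (fun y => nE (√y)) := by
  have hd : ∀ y ∈ Set.Ioi (0:ℝ), HasDerivAt (fun y => nE (√y)) (2 * nph (√y) * (1 / (2 * √y))) y := by
    intro y hy
    exact (nE_hasDerivAt _).comp y (Real.hasDerivAt_sqrt (ne_of_gt hy))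
  refine AntitoneOn.concaveOn_of_deriv (convex_Ici 0) ?_ ?_ ?_
  · exact (nE_cont.comp Real.continuous_sqrt).continuousOn
  · rw [interior_Ici]
    exact fun y hy => (hd y hy).differentiableAt.differentiableWithinAt
  · rw [interior_Ici]
    intro a ha b hb hab
    rw [(hd a ha).deriv, (hd b hb).deriv]
    have ha' : 0 < √a := Real.sqrt_pos.2 ha
    have hb' : 0 < √b := Real.sqrt_pos.2 hb
    have hab' : √a ≤ √b := Real.sqrt_le_sqrt hab
    rw [nph_eq, nph_eq]
    gcongr

lemma slice {N j : ℕ} (hj : 1 ≤ j) (v : Fin N → EuclideanSpace ℝ (Fin j))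
    (hsum : ∀ x y : EuclideanSpace ℝ (Fin j), ∑ i, inner ℝ (v i) x * inner ℝ (v i) y = inner ℝ x y)
    (w : Fin N → ℝ) {b : ℝ} (hb : 0 < b) :
    ProbabilityTheory.stdGaussian (EuclideanSpace ℝ (Fin j))
      {y | ∀ i, |inner ℝ (v i) y + w i| < b} ≤ ENNReal.ofReal (nE (b * √(N / j)) ^ j) := by
  classical
  set ι := {i : Fin N // v i ≠ 0} with hι
  have hvpos : ∀ i : ι, 0 < ‖v i‖ := fun i => norm_pos_iff.2 i.2
  set u : ι → EuclideanSpace ℝ (Fin j) := fun i => ‖v i‖⁻¹ • v i with hu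
  set c : ι → ℝ := fun i => ‖v i‖ ^ 2 with hc
  have hcpos : ∀ i, 0 < c i := fun i => by have := hvpos i; simp only [hc]; positivity
  have hu1 : ∀ i, ‖u i‖ = 1 := by
    intro i
    simp only [hu, norm_smul, norm_inv, norm_norm]
    exact inv_mul_cancel₀ (hvpos i).ne'
  have hui : ∀ i y, inner ℝ (u i) y = inner ℝ (v i) y / ‖v i‖ := by
    intro i y
    simp only [hu, real_inner_smul_left]; field_simp
  have hsum' : ∀ x y : EuclideanSpace ℝ (Fin j), ∑ i, c i * (inner ℝ (u i) x * inner ℝ (u i) y) = inner ℝ x y := by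
    intro x y
    rw [← hsum]
    have : ∀ i : ι, c i * (inner ℝ (u i) x * inner ℝ (u i) y) = inner ℝ (v i) x * inner ℝ (v i) y := by
      intro i
      rw [hui, hui]
      have := (hvpos i).ne'
      simp only [hc]; field_simp
    simp_rw [this]
    rw [← Finset.sum_subtype (Finset.univ.filter fun i => v i ≠ 0) (by simp)
      (fun i => (inner ℝ (v i) x * inner ℝ (v i) y : ℝ))]
    refine Finset.sum_filter_of_ne fun i _ h hv => h ?_
    rw [hv]; simp
  have hsc := sum_c_eq u c hu1 hsum'
  have hbl := brascamp_lieb u c hu1 hcpos hsum' (fun i => (-b - w i) / ‖v i‖) (fun i => (b - w i) / ‖v i‖)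
    (fun i => by
      have := hvpos i
      gcongr
      linarith)
  have hsub : {y | ∀ i, |inner ℝ (v i) y + w i| < b} ⊆
      {y | ∀ i : ι, inner ℝ (u i) y ∈ Set.Ioo ((-b - w i) / ‖v i‖) ((b - w i) / ‖v i‖)} := by
    intro y hy i
    have h1 := abs_lt.1 (hy i)
    have := hvpos i
    rw [hui]
    constructor
    · gcongr; linarith
    · gcongr; linarith
  refine (measure_mono hsub).trans (hbl.trans (ENNReal.ofReal_le_ofReal ?_))
  have hj0 : (0:ℝ) < j := by exact_mod_cast hj
  have hI : ∀ i : ι, ngm.real (Set.Ioo ((-b - w i) / ‖v i‖) ((b - w i) / ‖v i‖)) ≤ nE (√(b ^ 2 / c i)) := by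
    intro i
    have hp := hvpos i
    rw [ngm_Ioo (by gcongr; linarith)]
    have h1 := anderson (-w i / ‖v i‖) (r := b / ‖v i‖) (by positivity)
    have e1 : (b - w i) / ‖v i‖ = -w i / ‖v i‖ + b / ‖v i‖ := by ring
    have e2 : (-b - w i) / ‖v i‖ = -w i / ‖v i‖ - b / ‖v i‖ := by ring
    have e3 : √(b ^ 2 / c i) = b / ‖v i‖ := by
      simp only [hc]
      rw [← div_pow, Real.sqrt_sq (by positivity)]
    rw [e1, e2, e3]
    exact h1
  have hInn : ∀ i : ι, 0 ≤ ngm.real (Set.Ioo ((-b - w i) / ‖v i‖) ((b - w i) / ‖v i‖)) := fun i => measureReal_nonneg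
  have hEnn : ∀ i : ι, 0 ≤ nE (√(b ^ 2 / c i)) := fun i => nE_nonneg (Real.sqrt_nonneg _)
  have hw1 : ∑ i, c i / j = 1 := by
    rw [← Finset.sum_div, hsc, div_self hj0.ne']
  calc ∏ i : ι, ngm.real (Set.Ioo ((-b - w i) / ‖v i‖) ((b - w i) / ‖v i‖)) ^ c i
      ≤ ∏ i : ι, nE (√(b ^ 2 / c i)) ^ c i :=
        Finset.prod_le_prod (fun i _ => Real.rpow_nonneg (hInn i) _)
          fun i _ => Real.rpow_le_rpow (hInn i) (hI i) (hcpos i).le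
    _ = (∏ i : ι, nE (√(b ^ 2 / c i)) ^ (c i / j)) ^ j := by
        rw [← Finset.prod_pow]
        refine Finset.prod_congr rfl fun i _ => ?_
        rw [← Real.rpow_natCast _ j, ← Real.rpow_mul (hEnn i), div_mul_cancel₀ _ hj0.ne']
    _ ≤ nE (b * √(N / j)) ^ j := by
        refine pow_le_pow_left₀ (Finset.prod_nonneg fun i _ => Real.rpow_nonneg (hEnn i) _) ?_ _
        calc ∏ i : ι, nE (√(b ^ 2 / c i)) ^ (c i / j)
            ≤ ∑ i : ι, (c i / j) * nE (√(b ^ 2 / c i)) :=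
              Real.geom_mean_le_arith_mean_weighted _ _ _ (fun i _ => (div_pos (hcpos i) hj0).le) hw1 (fun i _ => hEnn i)
          _ ≤ nE (√(∑ i : ι, (c i / j) * (b ^ 2 / c i))) := by
              have := nE_sqrt_concave.le_map_sum (t := Finset.univ) (w := fun i : ι => c i / j)
                (p := fun i => b ^ 2 / c i) (fun i _ => (div_pos (hcpos i) hj0).le) hw1
                (fun i _ => by have := hcpos i; simp only [Set.mem_Ici]; positivity)
              simpa [smul_eq_mul] using this
          _ ≤ nE (b * √(N / j)) := by
              refine nE_strictMono.monotone ?_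
              have e1 : ∀ i : ι, (c i / j) * (b ^ 2 / c i) = b ^ 2 / j := by
                intro i; have := (hcpos i).ne'; field_simp
              simp_rw [e1]
              have e2 : b * √(N / j) = √(b ^ 2 * (N / j)) := by
                rw [Real.sqrt_mul (by positivity), Real.sqrt_sq hb.le]
              rw [e2]
              refine Real.sqrt_le_sqrt ?_
              rw [Finset.sum_const, nsmul_eq_mul]
              have hcard : (Finset.univ : Finset ι).card ≤ N := by
                rw [Finset.card_univ]
                exact (Fintype.card_subtype_le _).trans (by simp)
              have hcard' : ((Finset.univ : Finset ι).card : ℝ) ≤ N := by exact_mod_cast hcard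
              calc ((Finset.univ : Finset ι).card : ℝ) * (b ^ 2 / j) ≤ N * (b ^ 2 / j) := by gcongr
                _ = b ^ 2 * (N / j) := by ring

/-- Gaussian integral form of the right-hand side -/
def Kint (j : ℕ) (β : ℝ) : ENNReal := ∫⁻ s, ENNReal.ofReal (nE (β * |s|) ^ j) ∂ngm

lemma Kint_le_one (j : ℕ) {β : ℝ} (hβ : 0 ≤ β) : Kint j β ≤ 1 := by
  have : ∫⁻ s, ENNReal.ofReal (nE (β * |s|) ^ j) ∂ngm ≤ ∫⁻ s, 1 ∂ngm := by
    refine lintegral_mono fun s => ?_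
    rw [← ENNReal.ofReal_one]
    exact ENNReal.ofReal_le_ofReal (pow_le_one₀ (nE_nonneg (by positivity)) (nE_le_one _))
  simpa [Kint] using this

lemma ngm_ae_ne : ∀ᵐ s ∂ngm, s ≠ 0 := by
  have : NullSingletonClass ngm := ProbabilityTheory.nullSingletonClass_gaussianReal one_ne_zero
  rw [ae_iff]; simp

lemma Kint_meas (j : ℕ) (β : ℝ) : Measurable fun s : ℝ => ENNReal.ofReal (nE (β * |s|) ^ j) := by
  have := nE_cont
  have h : Continuous fun s : ℝ => nE (β * |s|) ^ j := by fun_prop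
  exact h.measurable.ennreal_ofReal

lemma Kint_strict {j : ℕ} (hj : 1 ≤ j) {α β : ℝ} (hα : 0 ≤ α) (h : α < β) : Kint j α < Kint j β := by
  refine lintegral_strict_mono (NeZero.ne _) (Kint_meas j β).aemeasurable
    ((Kint_le_one j hα).trans_lt ENNReal.one_lt_top).ne ?_
  filter_upwards [ngm_ae_ne] with s hs
  have hs' : 0 < |s| := abs_pos.2 hs
  have h1 : α * |s| < β * |s| := by gcongr
  have h2 := nE_strictMono h1
  have h0 : 0 ≤ nE (α * |s|) := nE_nonneg (by positivity)
  refine (ENNReal.ofReal_lt_ofReal_iff ?_).2 (pow_lt_pow_left₀ h2 h0 (by omega))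
  exact pow_pos (h0.trans_lt h2) _

lemma Kint_pos {j : ℕ} (hj : 1 ≤ j) {β : ℝ} (h : 0 < β) : 0 < Kint j β :=
  zero_le.trans_lt (Kint_strict hj le_rfl h)

lemma Kint_eq (j : ℕ) {κ : ℝ} (hκ : 0 < κ) : Kint j (√κ)⁻¹ = ENNReal.ofReal
    (√(2 / π) * √κ * ∫ t in Set.Ioi (0:ℝ), Real.exp (-κ * t ^ 2 / 2) * nE t ^ j) := by
  set β := (√κ)⁻¹ with hβ
  have hsκ : 0 < √κ := Real.sqrt_pos.2 hκ
  have hβpos : 0 < β := inv_pos.2 hsκ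
  have hE := nE_cont
  have hcont : Continuous fun s : ℝ => nE (β * |s|) ^ j := by fun_prop
  have hnn : ∀ s : ℝ, 0 ≤ nE (β * |s|) ^ j := fun s => pow_nonneg (nE_nonneg (by positivity)) _
  have hInteg : Integrable (fun s : ℝ => nE (β * |s|) ^ j) ngm := by
    refine Integrable.of_bound hcont.aestronglyMeasurable 1 (Filter.Eventually.of_forall fun s => ?_)
    rw [Real.norm_of_nonneg (hnn s)]
    exact pow_le_one₀ (nE_nonneg (by positivity)) (nE_le_one _)
  rw [Kint, ← ofReal_integral_eq_lintegral_ofReal hInteg (Filter.Eventually.of_forall hnn)]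
  congr 1
  rw [ProbabilityTheory.integral_gaussianReal_eq_integral_smul one_ne_zero]
  have h1 : (fun x : ℝ => ProbabilityTheory.gaussianPDFReal 0 1 x • nE (β * |x|) ^ j) =
      fun x => (fun y => nph y * nE (β * y) ^ j) |x| := by
    ext x
    have : nph |x| = nph x := by rw [nph_eq, nph_eq, sq_abs]
    simp only [smul_eq_mul, this]
  rw [h1, integral_comp_abs (f := fun y => nph y * nE (β * y) ^ j), ← integral_const_mul]
  have h2 := integral_comp_mul_left_Ioi (fun t => (Real.exp (-κ * t ^ 2 / 2) * nE t ^ j)) 0 hβpos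
  rw [mul_zero, hβ, inv_inv, ← hβ, smul_eq_mul] at h2
  rw [mul_assoc, ← h2, ← integral_const_mul]
  congr 1
  ext x
  rw [← mul_assoc, two_nph, ← mul_assoc]
  congr 3
  have : β ^ 2 = κ⁻¹ := by rw [hβ, inv_pow, Real.sq_sqrt hκ.le]
  rw [mul_pow, this]
  field_simp

lemma cone_bound {N j : ℕ} (hj : 1 ≤ j) (hN : 1 ≤ N) {m : ℝ} (hm : 0 < m)
    (v : Fin (N + 1) → EuclideanSpace ℝ (Fin (j + 1)))
    (hsum : ∀ x y : EuclideanSpace ℝ (Fin (j + 1)), ∑ i, inner ℝ (v i) x * inner ℝ (v i) y = inner ℝ x y)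
    (hlast : ‖v (Fin.last N)‖ < 1) :
    ProbabilityTheory.stdGaussian (EuclideanSpace ℝ (Fin (j + 1)))
      {a | inner ℝ (v (Fin.last N)) a ≠ 0 ∧
        ∀ i : Fin N, √m * |inner ℝ (v i.castSucc) a| ≤ |inner ℝ (v (Fin.last N)) a|} <
      Kint j (√(j * m / N))⁻¹ := by
  have hj0 : (0:ℝ) < j := by exact_mod_cast hj
  have hN0 : (0:ℝ) < N := by exact_mod_cast hN
  have hβ : 0 < (√(j * m / N))⁻¹ := inv_pos.2 (Real.sqrt_pos.2 (by positivity))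
  by_cases hv0 : v (Fin.last N) = 0
  · simp only [hv0, inner_zero_left, ne_eq, not_true_eq_false, false_and, Set.ofPred_false, measure_empty]
    exact Kint_pos hj hβ
  set c := ‖v (Fin.last N)‖ with hc
  have hcpos : 0 < c := norm_pos_iff.2 hv0
  obtain ⟨c', hcc', hc'1⟩ := exists_between hlast
  have hc'pos : 0 < c' := hcpos.trans hcc'
  have hsm : 0 < √m := Real.sqrt_pos.2 hm
  -- orthonormal basis
  obtain ⟨b, hb⟩ : ∃ b : OrthonormalBasis (Fin (j + 1)) ℝ (EuclideanSpace ℝ (Fin (j + 1))),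
      b 0 = c⁻¹ • v (Fin.last N) := by
    have := Orthonormal.exists_orthonormalBasis_extension_of_card_eq (𝕜 := ℝ)
      (E := EuclideanSpace ℝ (Fin (j + 1))) (ι := Fin (j + 1)) (by simp)
      (v := fun _ => c⁻¹ • v (Fin.last N)) (s := {0}) (by
        rw [orthonormal_iff_ite]
        rintro ⟨i, hi⟩ ⟨k, hk⟩
        have hik : i = k := by rw [Set.mem_singleton_iff] at hi hk; rw [hi, hk]
        subst hik
        simp only [Set.domRestrict_apply, if_true]
        rw [real_inner_smul_left, real_inner_smul_right, real_inner_self_eq_norm_sq, ← hc]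
        field_simp)
    obtain ⟨b, hb⟩ := this
    exact ⟨b, hb 0 (by simp)⟩
  have hvN : v (Fin.last N) = c • b 0 := by rw [hb, smul_smul, mul_inv_cancel₀ hcpos.ne', one_smul]
  have hvNb0 : (inner ℝ (v (Fin.last N)) (b 0) : ℝ) = c := by
    rw [hvN, real_inner_smul_left, real_inner_self_eq_norm_sq, b.norm_eq_one]; simp
  have hvNbs : ∀ l : Fin j, (inner ℝ (v (Fin.last N)) (b l.succ) : ℝ) = 0 := by
    intro l
    rw [hvN, real_inner_smul_left, b.orthonormal.2 (Fin.succ_ne_zero l).symm, mul_zero]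
  set v' : Fin N → EuclideanSpace ℝ (Fin j) :=
    fun i => WithLp.toLp 2 (fun l => inner ℝ (v i.castSucc) (b l.succ)) with hv'
  -- embedding
  set X : EuclideanSpace ℝ (Fin j) → EuclideanSpace ℝ (Fin (j + 1)) := fun y => ∑ l, y l • b l.succ with hX
  have hvX : ∀ i y, (inner ℝ (v' i) y : ℝ) = inner ℝ (v i.castSucc) (X y) := by
    intro i y
    simp only [hX, inner_sum, real_inner_smul_right]
    rw [PiLp.inner_apply]
    rfl
  have hvNX : ∀ y, (inner ℝ (v (Fin.last N)) (X y) : ℝ) = 0 := by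
    intro y
    simp only [hX, inner_sum, real_inner_smul_right, hvNbs, mul_zero, Finset.sum_const_zero]
  have hXX : ∀ x y, (inner ℝ (X x) (X y) : ℝ) = inner ℝ x y := by
    intro x y
    have hor : Orthonormal ℝ (fun l : Fin j => b l.succ) := b.orthonormal.comp _ (Fin.succ_injective j)
    simp only [hX]
    rw [hor.inner_sum]
    simp [PiLp.inner_apply, mul_comm]
  have hsum' : ∀ x y : EuclideanSpace ℝ (Fin j), ∑ i, inner ℝ (v' i) x * inner ℝ (v' i) y = inner ℝ x y := by
    intro x y
    rw [← hXX, ← hsum, Fin.sum_univ_castSucc, hvNX, zero_mul, add_zero]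
    simp only [hvX]
  set A : Set (EuclideanSpace ℝ (Fin (j + 1))) := {a | inner ℝ (v (Fin.last N)) a ≠ 0 ∧
        ∀ i : Fin N, √m * |inner ℝ (v i.castSucc) a| ≤ |inner ℝ (v (Fin.last N)) a|} with hA
  have hAm : MeasurableSet A := by
    refine MeasurableSet.inter ?_ ?_
    · exact (measurableSet_singleton (0:ℝ)).compl.preimage
        (by fun_prop : Measurable fun a : EuclideanSpace ℝ (Fin (j + 1)) => (inner ℝ (v (Fin.last N)) a : ℝ))
    · have : {a : EuclideanSpace ℝ (Fin (j + 1)) | ∀ i : Fin N, √m * |inner ℝ (v i.castSucc) a| ≤ |inner ℝ (v (Fin.last N)) a|} =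
          ⋂ i : Fin N, {a | √m * |inner ℝ (v i.castSucc) a| ≤ |inner ℝ (v (Fin.last N)) a|} := by
        ext; simp
      have h2 : MeasurableSet {a : EuclideanSpace ℝ (Fin (j + 1)) | ∀ i : Fin N, √m * |inner ℝ (v i.castSucc) a| ≤ |inner ℝ (v (Fin.last N)) a|} := by
        rw [this]
        exact MeasurableSet.iInter fun i => IsClosed.measurableSet (isClosed_le (by fun_prop) (by fun_prop))
      exact h2
  set Y : ℝ × (Fin j → ℝ) → EuclideanSpace ℝ (Fin (j + 1)) :=
    fun p => p.1 • b 0 + X (WithLp.toLp 2 p.2) with hY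
  have hYm : Measurable Y := by
    simp only [hY, hX]
    fun_prop
  have hmeas : ProbabilityTheory.stdGaussian (EuclideanSpace ℝ (Fin (j + 1))) A =
      (ngm.prod (Measure.pi fun _ : Fin j => ngm)) (Y ⁻¹' A) := by
    rw [ProbabilityTheory.stdGaussian_eq_map_pi_orthonormalBasis b]
    have hmp := measurePreserving_piFinSuccAbove (fun _ : Fin (j + 1) => ngm) 0
    have hfun : (fun x : Fin (j + 1) → ℝ => ∑ i, x i • b i) =
        Y ∘ (MeasurableEquiv.piFinSuccAbove (fun _ : Fin (j + 1) => ℝ) 0) := by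
      ext1 x
      simp [hY, hX, Fin.sum_univ_succ]
      rfl
    rw [Measure.map_apply (by fun_prop) hAm, hfun, Set.preimage_comp, hmp.measure_preimage (hYm hAm).nullMeasurableSet]
  rw [hmeas, Measure.prod_apply (hYm hAm)]
  refine lt_of_le_of_lt ?_ (Kint_strict hj (α := c' * (√(j * m / N))⁻¹) (by positivity)
    (by nlinarith : c' * (√(j * m / N))⁻¹ < (√(j * m / N))⁻¹))
  refine lintegral_mono fun s => ?_
  have hinner0 : ∀ x : Fin j → ℝ, (inner ℝ (v (Fin.last N)) (Y (s, x)) : ℝ) = c * s := by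
    intro x
    simp only [hY]
    rw [inner_add_right, hvNX, real_inner_smul_right, hvNb0]; ring
  have hinneri : ∀ (i : Fin N) (x : Fin j → ℝ), (inner ℝ (v i.castSucc) (Y (s, x)) : ℝ) =
      inner ℝ (v' i) (WithLp.toLp 2 x) + s * inner ℝ (v i.castSucc) (b 0) := by
    intro i x
    simp only [hY]
    rw [inner_add_right, hvX, real_inner_smul_right]; ring
  by_cases hs : s = 0
  · have : Prod.mk s ⁻¹' (Y ⁻¹' A) = ∅ := by
      refine Set.eq_empty_of_forall_notMem fun x hx => hx.1 ?_
      rw [hinner0, hs, mul_zero]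
    rw [this]; simp
  have hs' : 0 < |s| := abs_pos.2 hs
  have hbpos : 0 < c' * |s| / √m := by positivity
  have hsl := slice hj v' hsum' (fun i => s * inner ℝ (v i.castSucc) (b 0)) hbpos
  have hβeq : c' * |s| / √m * √(N / j) = c' * (√(j * m / N))⁻¹ * |s| := by
    rw [Real.sqrt_div (by positivity), Real.sqrt_div (by positivity), Real.sqrt_mul (by positivity)]
    field_simp
  rw [hβeq] at hsl
  refine le_trans ?_ hsl
  rw [← ProbabilityTheory.map_pi_eq_stdGaussian]
  refine le_trans ?_ (Measure.le_map_apply (by fun_prop) _)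
  refine measure_mono ?_
  intro x hx i
  simp only [hA, Set.mem_preimage, Set.mem_ofPred_eq, hinner0, hinneri] at hx
  have h1 := hx.2 i
  rw [abs_mul, abs_of_pos hcpos] at h1
  rw [lt_div_iff₀ hsm]
  calc _ = √m * |inner ℝ (v' i) (WithLp.toLp 2 x) + s * inner ℝ (v i.castSucc) (b 0)| := mul_comm _ _
    _ ≤ c * |s| := h1
    _ < c' * |s| := by gcongr

instance og_compact (n : ℕ) : CompactSpace (OG n) := by
  have hcl : IsClosed (Matrix.orthogonalGroup (Fin n) ℝ : Set (Matrix (Fin n) (Fin n) ℝ)) :=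
    isClosed_unitary
  have hK : IsCompact (Set.univ.pi fun _ : Fin n => Set.univ.pi fun _ : Fin n => Set.Icc (-1:ℝ) 1) :=
    isCompact_univ_pi fun _ => isCompact_univ_pi fun _ => isCompact_Icc
  have : IsCompact (Matrix.orthogonalGroup (Fin n) ℝ : Set (Matrix (Fin n) (Fin n) ℝ)) := by
    refine IsCompact.of_isClosed_subset hK hcl ?_
    intro U hU i _ j _
    have := entry_norm_bound_of_unitary hU i j
    rw [Real.norm_eq_abs, abs_le] at this
    exact this
  exact isCompact_iff_compactSpace.1 this

instance og_sc (n : ℕ) : SecondCountableTopology (OG n) := by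
  have : SecondCountableTopology (Matrix (Fin n) (Fin n) ℝ) :=
    inferInstanceAs (SecondCountableTopology (Fin n → Fin n → ℝ))
  exact TopologicalSpace.Subtype.secondCountableTopology _

lemma haar_right_inv {n : ℕ} (H : Measure (OG n)) [H.IsHaarMeasure] [IsProbabilityMeasure H] :
    H.IsMulRightInvariant := by
  constructor
  intro g
  have h1 : IsProbabilityMeasure (H.map (· * g)) :=
    Measure.isProbabilityMeasure_map (measurable_mul_const g).aemeasurable
  have h2 : (H.map (· * g)).IsHaarMeasure := Measure.isHaarMeasure_map_mul_right H g
  exact Measure.isHaarMeasure_eq_of_isProbabilityMeasure _ _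

lemma exists_haar (n : ℕ) : ∃ H : Measure (OG n), H.IsHaarMeasure ∧ IsProbabilityMeasure H := by
  refine ⟨Measure.haarMeasure ⊤, inferInstance, ⟨?_⟩⟩
  exact Measure.haarMeasure_self (K₀ := (⊤ : TopologicalSpace.PositiveCompacts (OG n)))

lemma act_apply {n : ℕ} (g : OG n) (x : EuclideanSpace ℝ (Fin n)) (i : Fin n) :
    act g x i = ∑ j, (g : Matrix _ _ ℝ) i j * x j := by
  simp [act, Matrix.toLpLin_apply, Matrix.mulVec, dotProduct]

lemma act_mul {n : ℕ} (g h : OG n) (x : EuclideanSpace ℝ (Fin n)) : act (g * h) x = act g (act h x) := by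
  simp [act, Matrix.toLpLin_apply, Matrix.mulVec_mulVec]

lemma act_one {n : ℕ} (x : EuclideanSpace ℝ (Fin n)) : act 1 x = x := by
  simp [act]

lemma act_inv_act {n : ℕ} (g : OG n) (x : EuclideanSpace ℝ (Fin n)) : act g⁻¹ (act g x) = x := by
  rw [← act_mul, inv_mul_cancel, act_one]

lemma act_act_inv {n : ℕ} (g : OG n) (x : EuclideanSpace ℝ (Fin n)) : act g (act g⁻¹ x) = x := by
  rw [← act_mul, mul_inv_cancel, act_one]

lemma act_inj {n : ℕ} (g : OG n) : Function.Injective (act g) :=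
  Function.LeftInverse.injective (g := act g⁻¹) (act_inv_act g)

lemma act_add {n : ℕ} (g : OG n) (x y : EuclideanSpace ℝ (Fin n)) : act g (x + y) = act g x + act g y :=
  map_add _ _ _

lemma act_smul {n : ℕ} (g : OG n) (c : ℝ) (x : EuclideanSpace ℝ (Fin n)) : act g (c • x) = c • act g x :=
  map_smul _ _ _

lemma act_zero {n : ℕ} (g : OG n) : act g (0 : EuclideanSpace ℝ (Fin n)) = 0 :=
  map_zero _

lemma act_cont {n : ℕ} : Continuous fun p : OG n × EuclideanSpace ℝ (Fin n) => act p.1 p.2 := by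
  have : (fun p : OG n × EuclideanSpace ℝ (Fin n) => act p.1 p.2) =
      fun p => WithLp.toLp 2 ((p.1 : Matrix _ _ ℝ).mulVec (WithLp.ofLp p.2)) := by
    ext p; simp [act, Matrix.toLpLin_apply]
  rw [this]
  refine (PiLp.continuous_toLp 2 _).comp ?_
  exact Continuous.matrix_mulVec (continuous_subtype_val.comp continuous_fst)
    ((PiLp.continuous_ofLp 2 _).comp continuous_snd)

lemma exists_og {n : ℕ} (f : EuclideanSpace ℝ (Fin n) ≃ₗᵢ[ℝ] EuclideanSpace ℝ (Fin n)) :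
    ∃ u : OG n, ∀ x, act u x = f x := by
  let b := EuclideanSpace.basisFun (Fin n) ℝ
  refine ⟨⟨_, LinearIsometryEquiv.toMatrix_mem_unitaryGroup f b b⟩, fun x => ?_⟩
  ext i
  rw [act_apply]
  have := LinearMap.toMatrix_mulVec_repr b.toBasis b.toBasis (f.toLinearEquiv : _ →ₗ[ℝ] _) x
  have := congrFun this i
  simpa [Matrix.mulVec, dotProduct, b] using this

lemma act_inner {n : ℕ} (g : OG n) (x y : EuclideanSpace ℝ (Fin n)) :
    (inner ℝ (act g x) (act g y) : ℝ) = inner ℝ x y := by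
  have h : Matrix.transpose (g : Matrix (Fin n) (Fin n) ℝ) * (g : Matrix (Fin n) (Fin n) ℝ) = 1 :=
    Matrix.UnitaryGroup.star_mul_self g
  rw [EuclideanSpace.inner_eq_star_dotProduct, EuclideanSpace.inner_eq_star_dotProduct]
  simp only [act, Matrix.toLpLin_apply, star_trivial]
  rw [Matrix.dotProduct_mulVec, Matrix.vecMul_mulVec, h, Matrix.vecMul_one]

/-- the event that the rotated set meets `S` -/
def hits {n : ℕ} (A S : Set (EuclideanSpace ℝ (Fin n))) : Set (OG n) :=
  {g | (act g '' A ∩ S).Nonempty}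

lemma mem_hits {n : ℕ} {A S : Set (EuclideanSpace ℝ (Fin n))} {g : OG n} :
    g ∈ hits A S ↔ ∃ x ∈ A, act g x ∈ S := by
  constructor
  · rintro ⟨y, ⟨x, hx, rfl⟩, hy⟩; exact ⟨x, hx, hy⟩
  · rintro ⟨x, hx, hy⟩; exact ⟨_, ⟨x, hx, rfl⟩, hy⟩

lemma hits_left {n : ℕ} (H : Measure (OG n)) [H.IsHaarMeasure] (u : OG n)
    (A S : Set (EuclideanSpace ℝ (Fin n))) : H (hits A (act u '' S)) = H (hits A S) := by
  rw [← measure_preimage_mul H u⁻¹ (hits A S)]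
  congr 1
  ext g
  simp only [Set.mem_preimage, mem_hits, act_mul]
  constructor
  · rintro ⟨x, hx, s, hs, h⟩
    exact ⟨x, hx, by rwa [← h, act_inv_act]⟩
  · rintro ⟨x, hx, h⟩
    exact ⟨x, hx, _, h, act_act_inv _ _⟩

/-- coordinate inclusion -/
def incl (r d : ℕ) (h : r ≤ d) : EuclideanSpace ℝ (Fin r) →ₗᵢ[ℝ] EuclideanSpace ℝ (Fin d) :=
  LinearMap.isometryOfInner
    { toFun := fun a => ∑ l, a l • EuclideanSpace.basisFun (Fin d) ℝ (Fin.castLE h l)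
      map_add' := by intro x y; simp [add_smul, Finset.sum_add_distrib]
      map_smul' := by intro c x; simp [mul_smul, Finset.smul_sum] }
    (by
      intro x y
      have hor : Orthonormal ℝ (fun l : Fin r => EuclideanSpace.basisFun (Fin d) ℝ (Fin.castLE h l)) :=
        (EuclideanSpace.basisFun (Fin d) ℝ).orthonormal.comp _ (Fin.castLE_injective h)
      change inner ℝ (∑ l, x l • EuclideanSpace.basisFun (Fin d) ℝ (Fin.castLE h l))
        (∑ l, y l • EuclideanSpace.basisFun (Fin d) ℝ (Fin.castLE h l)) = _
      rw [hor.inner_sum]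
      simp [PiLp.inner_apply, mul_comm])

lemma incl_apply {r d : ℕ} (h : r ≤ d) (a : EuclideanSpace ℝ (Fin r)) :
    incl r d h a = ∑ l, a l • EuclideanSpace.basisFun (Fin d) ℝ (Fin.castLE h l) := rfl

lemma incl_castLE {r d : ℕ} (h : r ≤ d) (a : EuclideanSpace ℝ (Fin r)) (l : Fin r) :
    incl r d h a (Fin.castLE h l) = a l := by
  rw [incl_apply]
  simp [Pi.single_apply]

lemma incl_ge {r d : ℕ} (h : r ≤ d) (a : EuclideanSpace ℝ (Fin r)) (i : Fin d) (hi : r ≤ i) :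
    incl r d h a i = 0 := by
  rw [incl_apply]
  simp only [WithLp.ofLp_sum, WithLp.ofLp_smul, Finset.sum_apply, Pi.smul_apply]
  refine Finset.sum_eq_zero fun l _ => ?_
  have : i ≠ Fin.castLE h l := by
    intro h'; have := congrArg Fin.val h'; have := l.2; simp at *; omega
  simp [this]

lemma range_incl {r d : ℕ} (h : r ≤ d) : Set.range (incl r d h) = Ek d r := by
  ext x
  constructor
  · rintro ⟨a, rfl⟩ i hi; exact incl_ge h a i hi
  · intro hx
    refine ⟨WithLp.toLp 2 fun l => x (Fin.castLE h l), ?_⟩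
    ext i
    by_cases hi : r ≤ i
    · rw [incl_ge h _ i hi, hx i hi]
    · have : i = Fin.castLE h ⟨i, not_le.1 hi⟩ := rfl
      rw [this, incl_castLE]

lemma SL {d : ℕ} (H : Measure (OG d)) [H.IsHaarMeasure] [IsProbabilityMeasure H]
    (W : Submodule ℝ (EuclideanSpace ℝ (Fin d))) {r : ℕ} (hr : Module.finrank ℝ W = r)
    (S : Set (EuclideanSpace ℝ (Fin d))) : H (hits (W : Set _) S) = H (hits (Ek d r) S) := by
  have hrd : r ≤ d := by
    rw [← hr]; simpa using W.finrank_le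
  let bW := (stdOrthonormalBasis ℝ W).reindex (finCongr hr)
  let T : EuclideanSpace ℝ (Fin r) →ₗᵢ[ℝ] EuclideanSpace ℝ (Fin d) :=
    W.subtypeₗᵢ.comp bW.repr.symm.toLinearIsometry
  let R := (incl r d hrd).equivRange
  let f := (LinearIsometry.extend (T.comp R.symm.toLinearIsometry)).toLinearIsometryEquiv rfl
  have hf : ∀ a, f (incl r d hrd a) = T a := by
    intro a
    have h1 : f (incl r d hrd a) = LinearIsometry.extend (T.comp R.symm.toLinearIsometry) (R a : EuclideanSpace ℝ (Fin d)) := rfl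
    rw [h1, LinearIsometry.extend_apply]
    simp
  obtain ⟨u, hu⟩ := exists_og f
  have hW : (W : Set (EuclideanSpace ℝ (Fin d))) = act u '' Ek d r := by
    rw [← range_incl hrd, ← Set.range_comp]
    ext x
    constructor
    · intro hx
      refine ⟨bW.repr ⟨x, hx⟩, ?_⟩
      simp only [Function.comp, hu, hf]
      simp [T]
    · rintro ⟨a, rfl⟩
      simp only [Function.comp, hu, hf]
      simp [T]
  have := haar_right_inv H
  rw [← measure_preimage_mul_right H u (hits (Ek d r) S)]
  congr 1
  ext g
  simp only [Set.mem_preimage, mem_hits, act_mul, hW, Set.exists_mem_image]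

lemma null_inner {d : ℕ} (H : Measure (OG d)) [H.IsHaarMeasure] [IsProbabilityMeasure H]
    {x y : EuclideanSpace ℝ (Fin d)} (hx : x ≠ 0) (hy : y ≠ 0) :
    H {g | (inner ℝ (act g x) y : ℝ) = 0} = 0 := by
  have key : ∀ x : EuclideanSpace ℝ (Fin d), x ≠ 0 → H {g | (inner ℝ (act g x) y : ℝ) = 0} =
      H (hits (Ek d 1) {z | z ≠ 0 ∧ (inner ℝ z y : ℝ) = 0}) := by
    intro x hx
    rw [← SL H (ℝ ∙ x) (finrank_span_singleton hx)]
    congr 1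
    ext g
    rw [mem_hits]
    simp only [Set.mem_ofPred_eq, SetLike.mem_coe, Submodule.mem_span_singleton]
    constructor
    · intro h
      exact ⟨x, ⟨1, one_smul _ _⟩, fun h' => hx (act_inj g (by rw [h', act_zero])), h⟩
    · rintro ⟨_, ⟨c, rfl⟩, h1, h2⟩
      rw [act_smul] at h1 h2
      rw [real_inner_smul_left] at h2
      rcases mul_eq_zero.1 h2 with h | h
      · simp [h] at h1
      · exact h
  have hs : MeasurableSet {p : EuclideanSpace ℝ (Fin d) × OG d | (inner ℝ (act p.2 p.1) y : ℝ) = 0} := by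
    have h1 : Continuous fun p : EuclideanSpace ℝ (Fin d) × OG d => act p.2 p.1 :=
      act_cont.comp continuous_swap
    exact (isClosed_eq (by fun_prop) continuous_const).measurableSet
  have h0 : ((volume : Measure (EuclideanSpace ℝ (Fin d))).prod H)
      {p | (inner ℝ (act p.2 p.1) y : ℝ) = 0} = 0 := by
    rw [Measure.prod_apply_symm hs, lintegral_eq_zero_iff (measurable_measure_prodMk_right hs)]
    refine Eventually.of_forall fun g => ?_
    let K : Submodule ℝ (EuclideanSpace ℝ (Fin d)) :=
      LinearMap.ker ((innerₛₗ ℝ y) ∘ₗ (Matrix.toEuclideanLin (g : Matrix (Fin d) (Fin d) ℝ)))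
    have hK : (K : Set (EuclideanSpace ℝ (Fin d))) = (fun x => (x, g)) ⁻¹'
        {p : EuclideanSpace ℝ (Fin d) × OG d | (inner ℝ (act p.2 p.1) y : ℝ) = 0} := by
      ext x
      simp only [K, SetLike.mem_coe, LinearMap.mem_ker, Set.mem_preimage, Set.mem_ofPred_eq]
      rw [real_inner_comm]; rfl
    simp only [Pi.zero_apply]
    rw [← hK]
    refine Measure.addHaar_submodule _ _ ?_
    intro hT
    have : act g⁻¹ y ∈ (K : Set (EuclideanSpace ℝ (Fin d))) := by rw [hT]; trivial
    rw [hK] at this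
    simp only [Set.mem_preimage, Set.mem_ofPred_eq, act_act_inv] at this
    exact hy (inner_self_eq_zero.1 this)
  have hae := Measure.measure_ae_null_of_prod_null h0
  have hn : Nontrivial (EuclideanSpace ℝ (Fin d)) := ⟨x, 0, hx⟩
  have hne : ∀ᵐ z : EuclideanSpace ℝ (Fin d), z ≠ 0 := by
    rw [ae_iff]; simp
  obtain ⟨z, hz1, hz2⟩ := (hae.and hne).exists
  rw [key x hx, ← key z hz2]
  exact hz1

lemma exists_og_incl {r d : ℕ} (h : r ≤ d) (T : EuclideanSpace ℝ (Fin r) →ₗᵢ[ℝ] EuclideanSpace ℝ (Fin d)) :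
    ∃ u : OG d, ∀ a, act u (incl r d h a) = T a := by
  let R := (incl r d h).equivRange
  let f := (LinearIsometry.extend (T.comp R.symm.toLinearIsometry)).toLinearIsometryEquiv rfl
  have hf : ∀ a, f (incl r d h a) = T a := by
    intro a
    have h1 : f (incl r d h a) = LinearIsometry.extend (T.comp R.symm.toLinearIsometry) (R a : EuclideanSpace ℝ (Fin d)) := rfl
    rw [h1, LinearIsometry.extend_apply]
    simp
  obtain ⟨u, hu⟩ := exists_og f
  exact ⟨u, fun a => by rw [hu, hf]⟩

/-- action as a linear isometry -/
def actL {n : ℕ} (g : OG n) : EuclideanSpace ℝ (Fin n) →ₗᵢ[ℝ] EuclideanSpace ℝ (Fin n) :=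
  LinearMap.isometryOfInner (Matrix.toEuclideanLin (g : Matrix (Fin n) (Fin n) ℝ)) (act_inner g)

lemma actL_apply {n : ℕ} (g : OG n) (x : EuclideanSpace ℝ (Fin n)) : actL g x = act g x := rfl

lemma incl_succ {d t : ℕ} (a : EuclideanSpace ℝ (Fin d)) :
    incl d (d + (t + 1)) (by omega) a = incl (d + t) (d + t + 1) (by omega) (incl d (d + t) (by omega) a) := by
  ext i
  by_cases hi : d ≤ i
  · rw [incl_ge _ _ _ hi]
    by_cases hi' : d + t ≤ i
    · exact (incl_ge (by omega : d + t ≤ d + t + 1) _ _ hi').symm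
    · have : i = Fin.castLE (by omega : d + t ≤ d + t + 1) ⟨i, not_le.1 hi'⟩ := rfl
      rw [this, incl_castLE]
      exact (incl_ge (by omega : d ≤ d + t) _ _ hi).symm
  · have h1 : i = Fin.castLE (by omega : d ≤ d + (t + 1)) ⟨i, not_le.1 hi⟩ := rfl
    have h2 : i = Fin.castLE (by omega : d + t ≤ d + t + 1) (Fin.castLE (by omega) (⟨i, not_le.1 hi⟩ : Fin d)) := rfl
    conv_lhs => rw [h1]
    conv_rhs => rw [h2]
    rw [incl_castLE, incl_castLE, incl_castLE]

lemma Ek_closed (n k : ℕ) : IsClosed (Ek n k) := by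
  have : Ek n k = ⋂ i : Fin n, ⋂ _ : k ≤ (i : ℕ), {x : EuclideanSpace ℝ (Fin n) | x i = 0} := by
    ext x; simp [Ek]
  rw [this]
  refine isClosed_iInter fun i => isClosed_iInter fun _ => isClosed_eq (by fun_prop) continuous_const

lemma finrank_W {d r : ℕ} (hr : r ≤ d) (g : OG (d + 1))
    (hg : (inner ℝ (act g (incl (r + 1) (d + 1) (by omega) (EuclideanSpace.single 0 1)))
      (EuclideanSpace.single (Fin.last d) (1:ℝ)) : ℝ) ≠ 0) :
    ∃ W : Submodule ℝ (EuclideanSpace ℝ (Fin d)), Module.finrank ℝ W = r ∧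
      ∀ x, x ∈ W ↔ incl d (d + 1) (by omega) x ∈ act g '' Ek (d + 1) (r + 1) := by
  let B : EuclideanSpace ℝ (Fin (r + 1)) →ₗᵢ[ℝ] EuclideanSpace ℝ (Fin (d + 1)) :=
    (actL g).comp (incl (r + 1) (d + 1) (by omega))
  let ι := incl d (d + 1) (by omega)
  let φ : Module.Dual ℝ (EuclideanSpace ℝ (Fin (r + 1))) :=
    (innerₛₗ ℝ (EuclideanSpace.single (Fin.last d) (1:ℝ))) ∘ₗ B.toLinearMap
  have hφ : φ ≠ 0 := by
    intro h
    apply hg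
    rw [real_inner_comm]
    exact LinearMap.congr_fun h (EuclideanSpace.single 0 1)
  have hker := Module.Dual.finrank_ker_add_one_of_ne_zero hφ
  simp only [finrank_euclideanSpace, Fintype.card_fin, add_left_inj] at hker
  have hrange : ∀ y, y ∈ LinearMap.range B.toLinearMap ↔ y ∈ act g '' Ek (d + 1) (r + 1) := by
    intro y
    rw [← range_incl (by omega), ← Set.range_comp]
    rfl
  let W := (LinearMap.range B.toLinearMap).comap ι.toLinearMap
  refine ⟨W, ?_, fun x => hrange _⟩
  have hmap : W.map ι.toLinearMap = (LinearMap.ker φ).map B.toLinearMap := by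
    rw [Submodule.map_comap_eq]
    ext y
    simp only [Submodule.mem_inf, Submodule.mem_map, LinearMap.mem_ker]
    have h1 : y ∈ LinearMap.range ι.toLinearMap ↔ y (Fin.last d) = 0 := by
      have : y ∈ LinearMap.range ι.toLinearMap ↔ y ∈ Ek (d + 1) d := by
        rw [← range_incl (by omega)]; rfl
      rw [this]
      constructor
      · intro h; exact h (Fin.last d) (by simp)
      · intro h i hi
        have : i = Fin.last d := by ext; simp; omega
        rw [this]; exact h
    have h2 : ∀ z, φ z = (B z) (Fin.last d) := by
      intro z
      simp [φ, EuclideanSpace.inner_single_left]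
    rw [h1]
    constructor
    · rintro ⟨h, z, rfl⟩
      exact ⟨z, by rw [h2]; exact h, rfl⟩
    · rintro ⟨z, hz, rfl⟩
      exact ⟨by rw [h2] at hz; exact hz, z, rfl⟩
  have e1 := (Submodule.equivMapOfInjective ι.toLinearMap ι.injective W).finrank_eq
  have e2 := (Submodule.equivMapOfInjective B.toLinearMap B.injective (LinearMap.ker φ)).finrank_eq
  rw [e1, hmap, ← e2, hker]

lemma meas_proj {X P Y : Type*} [TopologicalSpace X] [TopologicalSpace P] [TopologicalSpace Y]
    [CompactSpace P] [T2Space P] [MeasurableSpace P] [OpensMeasurableSpace P] {S : Set X} (hS : IsCompact S)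
    {f : X × P → Y} (hf : Continuous f) {E : Set Y} (hE : IsClosed E) :
    MeasurableSet {p | ∃ s ∈ S, f (s, p) ∈ E} := by
  have hK : IsCompact ((S ×ˢ (Set.univ : Set P)) ∩ f ⁻¹' E) :=
    (hS.prod isCompact_univ).inter_right (hE.preimage hf)
  have := (hK.image continuous_snd).isClosed.measurableSet
  convert this using 1
  ext p
  constructor
  · rintro ⟨s, hs, h⟩
    exact ⟨(s, p), ⟨⟨hs, trivial⟩, h⟩, rfl⟩
  · rintro ⟨⟨s, q⟩, ⟨⟨hs, -⟩, h⟩, rfl⟩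
    exact ⟨s, hs, h⟩

lemma act_cont2 {n : ℕ} {X : Type*} [TopologicalSpace X] {f : X → OG n} {g : X → EuclideanSpace ℝ (Fin n)}
    (hf : Continuous f) (hg : Continuous g) : Continuous fun x => act (f x) (g x) :=
  act_cont.comp (hf.prodMk hg)

lemma dim_red_cont {d : ℕ} (ι : EuclideanSpace ℝ (Fin d) →ₗᵢ[ℝ] EuclideanSpace ℝ (Fin (d + 1))) :
    Continuous fun q : EuclideanSpace ℝ (Fin d) × OG d × OG (d + 1) =>
        act q.2.2⁻¹ (ι (act q.2.1⁻¹ q.1)) := by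
  have i1 : Continuous fun q : EuclideanSpace ℝ (Fin d) × OG d × OG (d + 1) => q.2.1⁻¹ :=
    (continuous_fst.comp continuous_snd).inv
  have i2 : Continuous fun q : EuclideanSpace ℝ (Fin d) × OG d × OG (d + 1) => q.2.2⁻¹ :=
    (continuous_snd.comp continuous_snd).inv
  exact act_cont2 i2 (ι.continuous.comp (act_cont2 i1 continuous_fst))

lemma dim_red {d r : ℕ} (hr : r ≤ d) (H' : Measure (OG (d + 1))) [H'.IsHaarMeasure] [IsProbabilityMeasure H']
    (H : Measure (OG d)) [H.IsHaarMeasure] [IsProbabilityMeasure H]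
    {S : Set (EuclideanSpace ℝ (Fin d))} (hS : IsCompact S) :
    H' (hits (Ek (d + 1) (r + 1)) (incl d (d + 1) (by omega) '' S)) = H (hits (Ek d r) S) := by
  set ι := incl d (d + 1) (by omega) with hι
  set E := Ek (d + 1) (r + 1) with hE
  set Z : Set (OG d × OG (d + 1)) := {p | ∃ s ∈ S, act p.2⁻¹ (ι (act p.1⁻¹ s)) ∈ E} with hZ
  have hZm : MeasurableSet Z := by
    exact meas_proj hS (dim_red_cont ι) (Ek_closed _ _)
  have h1 : (H.prod H') Z = H' (hits E (ι '' S)) := by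
    rw [Measure.prod_apply hZm]
    have : ∀ h : OG d, H' (Prod.mk h ⁻¹' Z) = H' (hits E (ι '' S)) := by
      intro h
      obtain ⟨u, hu⟩ := exists_og_incl (by omega : d ≤ d + 1) (ι.comp (actL h⁻¹))
      rw [← hits_left H' u]
      congr 1
      ext g
      rw [mem_hits]
      constructor
      · rintro ⟨s, hs, h'⟩
        refine ⟨_, h', _, ⟨s, hs, rfl⟩, ?_⟩
        rw [act_act_inv, hι, hu]; rfl
      · rintro ⟨x, hx, _, ⟨s, hs, rfl⟩, h'⟩
        refine ⟨s, hs, ?_⟩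
        rw [hι, hu] at h'
        have h'' : ι (act h⁻¹ s) = act g x := h'
        change act g⁻¹ (ι (act h⁻¹ s)) ∈ E
        rw [h'', act_inv_act]; exact hx
    simp [this]
  have h2 : (H.prod H') Z = H (hits (Ek d r) S) := by
    rw [Measure.prod_apply_symm hZm]
    have hn := null_inner H' (x := incl (r + 1) (d + 1) (by omega) (EuclideanSpace.single 0 1))
      (y := EuclideanSpace.single (Fin.last d) (1:ℝ))
      (by
        intro h
        have h := congrArg norm h
        simp at h)
      (by
        intro h
        have h := congrArg norm h
        simp at h)
    have hae : ∀ᵐ g ∂H', H ((fun h => (h, g)) ⁻¹' Z) = H (hits (Ek d r) S) := by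
      filter_upwards [(measure_eq_zero_iff_ae_notMem.1 hn)] with g hg
      obtain ⟨W, hW, hW2⟩ := finrank_W hr g hg
      rw [← SL H W hW]
      congr 1
      ext h
      rw [mem_hits]
      constructor
      · rintro ⟨s, hs, h'⟩
        refine ⟨act h⁻¹ s, (hW2 _).2 ⟨_, h', act_act_inv _ _⟩, by rwa [act_act_inv]⟩
      · rintro ⟨x, hx, h'⟩
        refine ⟨_, h', ?_⟩
        obtain ⟨y, hy, hyx⟩ := (hW2 _).1 hx
        change act g⁻¹ (ι (act h⁻¹ (act h x))) ∈ E
        rw [act_inv_act, hι, ← hyx, act_inv_act]; exact hy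
    rw [lintegral_congr_ae hae]; simp
  rw [← h1, h2]

lemma dim_red_iter {d r : ℕ} (hr : r ≤ d) (H : Measure (OG d)) [H.IsHaarMeasure] [IsProbabilityMeasure H]
    {S : Set (EuclideanSpace ℝ (Fin d))} (hS : IsCompact S) (t : ℕ) :
    ∀ (H' : Measure (OG (d + t))) [H'.IsHaarMeasure] [IsProbabilityMeasure H'],
    H' (hits (Ek (d + t) (r + t)) (incl d (d + t) (by omega) '' S)) = H (hits (Ek d r) S) := by
  induction t with
  | zero =>
    intro H' _ _
    have h1 : H' = H := Measure.isHaarMeasure_eq_of_isProbabilityMeasure _ _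
    have h2 : incl d (d + 0) (by omega) '' S = S := by
      have : ∀ a, incl d (d + 0) (by omega) a = a := by
        intro a; ext i
        exact incl_castLE (by omega : d ≤ d + 0) a i
      rw [Set.image_congr (fun a _ => this a)]; exact Set.image_id _
    rw [h2, h1]; rfl
  | succ t ih =>
    intro H' _ _
    obtain ⟨H1, _, _⟩ := exists_haar (d + t)
    rw [← ih H1, ← dim_red (by omega : r + t ≤ d + t) H' H1
      (hS.image (incl d (d + t) (by omega)).continuous), Set.image_image]
    congr 2
    exact Set.image_congr fun a _ => incl_succ a

/-- the rotated face, living in dimension `N + 1` -/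
def topFace (N m : ℕ) : Set (EuclideanSpace ℝ (Fin (N + 1))) :=
  {x | (∀ i : Fin N, |x i.castSucc| ≤ 1) ∧ x (Fin.last N) = √m}

lemma topFace_compact (N m : ℕ) : IsCompact (topFace N m) := by
  have hcl : IsClosed (topFace N m) := by
    have : topFace N m = (⋂ i : Fin N, {x : EuclideanSpace ℝ (Fin (N + 1)) | |x i.castSucc| ≤ 1}) ∩
        {x | x (Fin.last N) = √m} := by
      ext x; simp [topFace]
    rw [this]
    exact (isClosed_iInter fun i => isClosed_le (by fun_prop) continuous_const).inter
      (isClosed_eq (by fun_prop) continuous_const)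
  refine Metric.isCompact_of_isClosed_isBounded hcl ?_
  rw [isBounded_iff_forall_norm_le]
  refine ⟨√(N + m), fun x hx => ?_⟩
  rw [EuclideanSpace.norm_eq, Fin.sum_univ_castSucc]
  refine Real.sqrt_le_sqrt ?_
  rw [hx.2, Real.norm_eq_abs, sq_abs, Real.sq_sqrt (by positivity)]
  gcongr
  calc ∑ i : Fin N, ‖x i.castSucc‖ ^ 2 ≤ ∑ i : Fin N, 1 := by
        refine Finset.sum_le_sum fun i _ => ?_
        exact pow_le_one₀ (norm_nonneg _) (hx.1 i)
    _ = N := by simp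

lemma face_iso {n N m : ℕ} (hn : n = N + m) (hm : 1 ≤ m) :
    ∃ T : EuclideanSpace ℝ (Fin (N + 1)) →ₗᵢ[ℝ] EuclideanSpace ℝ (Fin n), T '' topFace N m = cubeFace n N := by
  subst hn
  have hm0 : (0:ℝ) < m := by exact_mod_cast hm
  have hs : 0 < √(m:ℝ) := Real.sqrt_pos.2 hm0
  let T0 : EuclideanSpace ℝ (Fin (N + 1)) →ₗ[ℝ] EuclideanSpace ℝ (Fin (N + m)) :=
    { toFun := fun a => WithLp.toLp 2 (Fin.append (fun i : Fin N => a i.castSucc)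
        (fun _ : Fin m => a (Fin.last N) / √m))
      map_add' := by
        intro x y; ext i
        refine Fin.addCases (fun i => ?_) (fun i => ?_) i
        · simp
        · simp [add_div]
      map_smul' := by
        intro c x; ext i
        refine Fin.addCases (fun i => ?_) (fun i => ?_) i
        · simp
        · simp [mul_div_assoc] }
  have hl : ∀ a (i : Fin N), T0 a (Fin.castAdd m i) = a i.castSucc := by intro a i; simp [T0]
  have hr : ∀ a (i : Fin m), T0 a (Fin.natAdd N i) = a (Fin.last N) / √m := by intro a i; simp [T0]
  let T := T0.isometryOfInner (by
    intro x y
    rw [PiLp.inner_apply, PiLp.inner_apply, Fin.sum_univ_add, Fin.sum_univ_castSucc]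
    simp only [hl, hr]
    congr 1
    simp only [RCLike.inner_apply, conj_trivial, Finset.sum_const, Finset.card_univ, Fintype.card_fin, nsmul_eq_mul]
    have := Real.mul_self_sqrt hm0.le
    field_simp
    rw [pow_two, this]; ring)
  refine ⟨T, ?_⟩
  have hT : ∀ a, T a = T0 a := fun _ => rfl
  ext x
  constructor
  · rintro ⟨a, ⟨h1, h2⟩, rfl⟩
    constructor
    · intro i hi
      have : i = Fin.castAdd m ⟨i, hi⟩ := rfl
      rw [this, hT, hl]; exact h1 _
    · intro i hi
      have : i = Fin.natAdd N ⟨i - N, by omega⟩ := by ext; simp; omega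
      rw [this, hT, hr, h2, div_self hs.ne']
  · rintro ⟨h1, h2⟩
    refine ⟨WithLp.toLp 2 (Fin.snoc (fun i : Fin N => x (Fin.castAdd m i)) √m), ⟨?_, ?_⟩, ?_⟩
    · intro i
      simpa using h1 (Fin.castAdd m i) (by simp)
    · simp
    · ext i
      rw [hT]
      refine Fin.addCases (fun i => ?_) (fun i => ?_) i
      · rw [hl]; simp
      · rw [hr, h2 _ (by simp)]; simp [hs.ne']

lemma reduce {n N m t k r : ℕ} (hm : m = t + 1) (hn : n = N + m) (hk : k = r + t) (hr : r ≤ N + 1)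
    (H : Measure (OG n)) [H.IsHaarMeasure] [IsProbabilityMeasure H]
    (H1 : Measure (OG (N + 1))) [H1.IsHaarMeasure] [IsProbabilityMeasure H1] :
    H (hits (Ek n k) (cubeFace n N)) = H1 (hits (Ek (N + 1) r) (topFace N m)) := by
  obtain ⟨T, hT⟩ := face_iso hn (by omega)
  obtain ⟨u, hu⟩ := exists_og_incl (by omega : N + 1 ≤ n) T
  have : cubeFace n N = act u '' (incl (N + 1) n (by omega) '' topFace N m) := by
    rw [← hT, Set.image_image]
    exact Set.image_congr fun a _ => (hu a).symm
  rw [this, hits_left]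
  have hn' : n = N + 1 + t := by omega
  subst hn' hk
  exact dim_red_iter hr H1 (topFace_compact N m) t H

/-- the double cone over the rotated face -/
def dcone (N m : ℕ) : Set (EuclideanSpace ℝ (Fin (N + 1))) :=
  {x | x (Fin.last N) ≠ 0 ∧ ∀ i : Fin N, √(m:ℝ) * |x i.castSucc| ≤ |x (Fin.last N)|}

lemma dcone_meas (N m : ℕ) : MeasurableSet (dcone N m) := by
  have : dcone N m = {x : EuclideanSpace ℝ (Fin (N + 1)) | x (Fin.last N) = 0}ᶜ ∩
      ⋂ i : Fin N, {x : EuclideanSpace ℝ (Fin (N + 1)) | √(m:ℝ) * |x i.castSucc| ≤ |x (Fin.last N)|} := by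
    ext x; simp [dcone]
  rw [this]
  refine (IsClosed.measurableSet (isClosed_eq (by fun_prop) continuous_const)).compl.inter ?_
  exact MeasurableSet.iInter fun i => IsClosed.measurableSet (isClosed_le (by fun_prop) (by fun_prop))

lemma dcone_hits {N m : ℕ} (hm : 1 ≤ m) (x : EuclideanSpace ℝ (Fin (N + 1))) (h : OG (N + 1)) :
    act h x ∈ dcone N m ↔ h ∈ hits ((ℝ ∙ x : Submodule ℝ _) : Set (EuclideanSpace ℝ (Fin (N + 1)))) (topFace N m) := by
  have hm0 : (0:ℝ) < m := by exact_mod_cast hm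
  have hs : 0 < √(m:ℝ) := Real.sqrt_pos.2 hm0
  rw [mem_hits]
  simp only [SetLike.mem_coe, Submodule.mem_span_singleton]
  constructor
  · rintro ⟨h1, h2⟩
    refine ⟨_, ⟨√m / act h x (Fin.last N), rfl⟩, ?_, ?_⟩
    · intro i
      rw [act_smul]
      simp only [PiLp.smul_apply, smul_eq_mul]
      rw [abs_mul, abs_div, abs_of_pos hs, div_mul_eq_mul_div, div_le_one (abs_pos.2 h1)]
      exact h2 i
    · rw [act_smul]
      simp only [PiLp.smul_apply, smul_eq_mul]
      field_simp
  · rintro ⟨_, ⟨c, rfl⟩, h1, h2⟩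
    rw [act_smul] at h1 h2
    simp only [PiLp.smul_apply, smul_eq_mul] at h1 h2
    have hne : c * act h x (Fin.last N) ≠ 0 := by rw [h2]; exact hs.ne'
    have hc : 0 < |c| := abs_pos.2 (left_ne_zero_of_mul hne)
    refine ⟨right_ne_zero_of_mul hne, fun i => ?_⟩
    have h3 := h1 i
    have h4 : |c| * |act h x (Fin.last N)| = √m := by rw [← abs_mul, h2, abs_of_pos hs]
    rw [abs_mul] at h3
    refine le_of_mul_le_mul_left ?_ hc
    rw [h4]
    nlinarith

lemma hits_meas {d r : ℕ} {S : Set (EuclideanSpace ℝ (Fin d))} (hS : IsCompact S) :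
    MeasurableSet (hits (Ek d r) S) := by
  have hc : Continuous fun q : EuclideanSpace ℝ (Fin d) × OG d => act q.2⁻¹ q.1 :=
    act_cont2 continuous_snd.inv continuous_fst
  have := meas_proj hS hc (Ek_closed d r)
  convert this using 1
  ext h
  rw [mem_hits]
  constructor
  · rintro ⟨x, hx, h'⟩
    refine ⟨_, h', ?_⟩
    change act h⁻¹ (act h x) ∈ _
    rwa [act_inv_act]
  · rintro ⟨s, hs, h'⟩
    exact ⟨_, h', by rwa [act_act_inv]⟩

lemma fiber_bound {N j m : ℕ} (hj : 1 ≤ j) (hjN : j + 1 ≤ N) (hm : 1 ≤ m) (h : OG (N + 1))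
    (hh : (inner ℝ (act h (EuclideanSpace.single (Fin.last N) (1:ℝ))) (EuclideanSpace.single (Fin.last N) (1:ℝ)) : ℝ) ≠ 0) :
    ProbabilityTheory.stdGaussian (EuclideanSpace ℝ (Fin (j + 1)))
      {a | act h (incl (j + 1) (N + 1) (by omega) a) ∈ dcone N m} < Kint j (√(j * m / N))⁻¹ := by
  have hle : j + 1 ≤ N + 1 := by omega
  set v : Fin (N + 1) → EuclideanSpace ℝ (Fin (j + 1)) := fun i =>
    WithLp.toLp 2 fun l => act h (EuclideanSpace.basisFun (Fin (N + 1)) ℝ (Fin.castLE hle l)) i with hv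
  have hva : ∀ i a, (inner ℝ (v i) a : ℝ) = act h (incl (j + 1) (N + 1) hle a) i := by
    intro i a
    have : act h (incl (j + 1) (N + 1) hle a) =
        ∑ l, a l • act h (EuclideanSpace.basisFun (Fin (N + 1)) ℝ (Fin.castLE hle l)) := by
      rw [incl_apply, ← actL_apply, map_sum]
      simp only [map_smul, actL_apply]
    rw [this, PiLp.inner_apply]
    simp only [WithLp.ofLp_sum, WithLp.ofLp_smul, Finset.sum_apply, Pi.smul_apply]
    rfl
  have hsum : ∀ x y : EuclideanSpace ℝ (Fin (j + 1)), ∑ i, inner ℝ (v i) x * inner ℝ (v i) y = inner ℝ x y := by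
    intro x y
    rw [← (incl (j + 1) (N + 1) hle).inner_map_map, ← act_inner h, PiLp.inner_apply]
    simp only [hva]
    exact Finset.sum_congr rfl fun i _ => mul_comm _ _
  set e := EuclideanSpace.single (Fin.last N) (1:ℝ) with he
  set w := act h⁻¹ e with hw
  have hwi : ∀ i, act h (EuclideanSpace.basisFun (Fin (N + 1)) ℝ i) (Fin.last N) = w i := by
    intro i
    have h1 : act h (EuclideanSpace.basisFun (Fin (N + 1)) ℝ i) (Fin.last N) =
        inner ℝ e (act h (EuclideanSpace.basisFun (Fin (N + 1)) ℝ i)) := by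
      rw [he, EuclideanSpace.inner_single_left]; simp
    rw [h1, ← act_inner h⁻¹, act_inv_act, ← hw, EuclideanSpace.basisFun_apply, EuclideanSpace.inner_single_right]
    simp
  have hwlast : w (Fin.last N) ≠ 0 := by
    rw [← hwi, EuclideanSpace.basisFun_apply]
    intro h0
    apply hh
    rw [he, EuclideanSpace.inner_single_right]
    simpa using h0
  have hwn : ∑ i, (w i) ^ 2 = 1 := by
    have : (inner ℝ w w : ℝ) = 1 := by
      rw [hw, act_inner, real_inner_self_eq_norm_sq, he]; simp
    rw [← this, PiLp.inner_apply]
    refine Finset.sum_congr rfl fun i _ => ?_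
    simp [pow_two]
  have hlast : ‖v (Fin.last N)‖ < 1 := by
    rw [← sq_lt_one_iff₀ (norm_nonneg _), EuclideanSpace.real_norm_sq_eq]
    simp only [hv, hwi]
    calc ∑ l : Fin (j + 1), w (Fin.castLE hle l) ^ 2
        = ∑ i ∈ Finset.univ.map (Fin.castLEEmb hle), w i ^ 2 := by
          rw [Finset.sum_map]; rfl
      _ ≤ ∑ i ∈ Finset.univ.erase (Fin.last N), w i ^ 2 := by
          refine Finset.sum_le_sum_of_subset_of_nonneg ?_ fun i _ _ => sq_nonneg _
          intro i hi
          obtain ⟨l, -, rfl⟩ := Finset.mem_map.1 hi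
          refine Finset.mem_erase.2 ⟨?_, Finset.mem_univ _⟩
          intro h'
          have h1 := congrArg Fin.val h'
          have h2 := l.2
          simp at h1
          omega
      _ < ∑ i, w i ^ 2 := by
          rw [← Finset.sum_erase_add _ _ (Finset.mem_univ (Fin.last N))]
          have : 0 < w (Fin.last N) ^ 2 := by positivity
          linarith
      _ = 1 := hwn
  have := cone_bound hj (by omega) (by exact_mod_cast hm : (0:ℝ) < m) v hsum hlast
  simp only [hva] at this
  exact this

lemma main_ineq {N j m : ℕ} (hj : 1 ≤ j) (hjN : j + 1 ≤ N) (hm : 1 ≤ m)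
    (H : Measure (OG (N + 1))) [H.IsHaarMeasure] [IsProbabilityMeasure H]
    (hpos : H (hits (Ek (N + 1) (j + 1)) (topFace N m)) ≠ 0) :
    H (hits (Ek (N + 1) 1) (topFace N m)) <
      Kint j (√(j * m / N))⁻¹ * H (hits (Ek (N + 1) (j + 1)) (topFace N m)) := by
  have hle : j + 1 ≤ N + 1 := by omega
  set G := ProbabilityTheory.stdGaussian (EuclideanSpace ℝ (Fin (j + 1))) with hG
  set ι := incl (j + 1) (N + 1) hle with hι
  set p := H (hits (Ek (N + 1) 1) (topFace N m)) with hp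
  set B := hits (Ek (N + 1) (j + 1)) (topFace N m) with hB
  have hBm : MeasurableSet B := hits_meas (topFace_compact N m)
  set Z : Set (EuclideanSpace ℝ (Fin (j + 1)) × OG (N + 1)) := {q | act q.2 (ι q.1) ∈ dcone N m} with hZ
  have hZm : MeasurableSet Z := by
    have hc : Continuous fun q : EuclideanSpace ℝ (Fin (j + 1)) × OG (N + 1) => act q.2 (ι q.1) :=
      act_cont2 continuous_snd (ι.continuous.comp continuous_fst)
    exact hc.measurable (dcone_meas N m)
  have hG0 : ∀ᵐ a ∂G, a ≠ 0 := by
    rw [ae_iff]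
    simp only [not_not]
    rw [hG, stdGaussian_density _ _ (measurableSet_eq)]
    have : Nontrivial (EuclideanSpace ℝ (Fin (j + 1))) := inferInstance
    have h0 : (volume : Measure (EuclideanSpace ℝ (Fin (j + 1)))) {a | a = 0} = 0 := by simp
    rw [Measure.restrict_eq_zero.2 h0, lintegral_zero_measure]
  have h1 : (G.prod H) Z = p := by
    rw [Measure.prod_apply hZm]
    have : ∀ᵐ a ∂G, H (Prod.mk a ⁻¹' Z) = p := by
      filter_upwards [hG0] with a ha
      have ha' : ι a ≠ 0 := by
        intro h; exact ha (ι.injective (by rw [h, map_zero]))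
      rw [hp, ← SL H (ℝ ∙ ι a) (finrank_span_singleton ha')]
      congr 1
      ext h
      exact dcone_hits hm (ι a) h
    rw [lintegral_congr_ae this]; simp
  have hK1 : Kint j (√(j * m / N))⁻¹ ≤ 1 := Kint_le_one j (by positivity)
  rw [← h1, Measure.prod_apply_symm hZm, ← lintegral_indicator_const hBm]
  have hlt : ∀ᵐ h ∂H, G ((fun a => (a, h)) ⁻¹' Z) < Kint j (√(j * m / N))⁻¹ := by
    have he : EuclideanSpace.single (Fin.last N) (1:ℝ) ≠ 0 := by
      intro h
      have h := congrArg norm h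
      simp at h
    filter_upwards [measure_eq_zero_iff_ae_notMem.1 (null_inner H he he)] with h hh
    exact fiber_bound hj hjN hm h hh
  have hout : ∀ h ∉ B, G ((fun a => (a, h)) ⁻¹' Z) = 0 := by
    intro h hh
    have : (fun a => (a, h)) ⁻¹' Z = ∅ := by
      refine Set.eq_empty_of_forall_notMem fun a ha => hh ?_
      obtain ⟨x, hx, hx'⟩ := mem_hits.1 ((dcone_hits hm (ι a) h).1 ha)
      refine mem_hits.2 ⟨x, ?_, hx'⟩
      obtain ⟨c, rfl⟩ := Submodule.mem_span_singleton.1 hx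
      rw [← range_incl hle]
      exact ⟨c • a, by rw [map_smul]⟩
    rw [this, measure_empty]
  refine lintegral_strict_mono_of_ae_le_of_ae_lt_on (s := B) ?_ ?_ ?_ hpos ?_
  · exact (measurable_const.indicator hBm).aemeasurable
  · rw [← Measure.prod_apply_symm hZm]
    exact measure_ne_top _ _
  · filter_upwards [hlt] with h hh
    by_cases hb : h ∈ B
    · rw [Set.indicator_of_mem hb]; exact hh.le
    · rw [hout h hb]; exact zero_le
  · filter_upwards [hlt] with h hh hb
    rw [Set.indicator_of_mem hb]; exact hh

theorem faces_ratio_upper_bound (n j k : ℕ) (hj : 1 ≤ j) (hjk : j < k) (hkn : k < n)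
    (H : Measure (OG n)) [H.IsHaarMeasure] [IsProbabilityMeasure H] :
    expFaces n H 0 (k - j) / expFaces n H j k <
      Real.sqrt (2 / π) *
        Real.sqrt ((j : ℝ) * ((k : ℝ) - j) / ((n : ℝ) - k + j)) *
        ∫ t in Set.Ioi (0 : ℝ),
          Real.exp (-((j : ℝ) * ((k : ℝ) - j) / ((n : ℝ) - k + j)) * t ^ 2 / 2) *
            (Real.sqrt (2 / π) * ∫ x in (0 : ℝ)..t, Real.exp (-x ^ 2 / 2)) ^ j := by
  obtain ⟨m, rfl⟩ : ∃ m, k = j + m := ⟨k - j, by omega⟩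
  obtain ⟨N, rfl⟩ : ∃ N, n = N + m := ⟨n - m, by omega⟩
  have hm : 1 ≤ m := by omega
  have hjN : j + 1 ≤ N := by omega
  have hj0 : (0:ℝ) < j := by exact_mod_cast hj
  have hm0 : (0:ℝ) < m := by exact_mod_cast hm
  have hN0 : (0:ℝ) < N := by exact_mod_cast (by omega : 0 < N)
  have hκ : (j : ℝ) * (((j + m : ℕ) : ℝ) - j) / (((N + m : ℕ) : ℝ) - ((j + m : ℕ) : ℝ) + j) = j * m / N := by
    push_cast
    congr 1 <;> ring
  rw [hκ]
  have hκpos : (0:ℝ) < j * m / N := by positivity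
  obtain ⟨H1, _, _⟩ := exists_haar (N + 1)
  set F := topFace N m
  set p := H1 (hits (Ek (N + 1) 1) F) with hp
  set q := H1 (hits (Ek (N + 1) (j + 1)) F) with hq
  have hK := Kint_eq j hκpos
  have hKpos : 0 < Kint j (√(j * m / N))⁻¹ := Kint_pos hj (by positivity)
  have hrhs : √(2 / π) * √(j * m / N) * ∫ t in Set.Ioi (0:ℝ), Real.exp (-(j * m / N : ℝ) * t ^ 2 / 2) * nE t ^ j =
      (Kint j (√(j * m / N))⁻¹).toReal := by
    rw [hK, ENNReal.toReal_ofReal]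
    by_contra hneg
    rw [hK, ENNReal.ofReal_of_nonpos (not_le.1 hneg).le] at hKpos
    exact lt_irrefl _ hKpos
  have hKtop : Kint j (√(j * m / N))⁻¹ ≠ ⊤ := by rw [hK]; exact ENNReal.ofReal_ne_top
  have hgoal : (√(2 / π) * √(j * m / N) * ∫ t in Set.Ioi (0:ℝ), Real.exp (-(j * m / N : ℝ) * t ^ 2 / 2) *
      (√(2 / π) * ∫ x in (0 : ℝ)..t, Real.exp (-x ^ 2 / 2)) ^ j) = (Kint j (√(j * m / N))⁻¹).toReal := hrhs
  rw [hgoal]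
  have e1 : expFaces (N + m) H 0 (j + m - j) = 2 ^ m * ((N + m).choose m) * p.toReal := by
    have h1 : j + m - j - 0 = m := by omega
    have h2 : N + m - (j + m - j) + 0 = N := by omega
    have h3 : j + m - j = m := by omega
    have h := reduce (N := N) (m := m) (t := m - 1) (k := m) (r := 1) (by omega) rfl (by omega) (by omega) H H1
    rw [expFaces, h1, h2, h3, hp, ← h]; rfl
  have e2 : expFaces (N + m) H j (j + m) = 2 ^ m * ((N + m).choose m) * q.toReal := by
    have h2 : N + m - (j + m) + j = N := by omega
    have h3 : j + m - j = m := by omega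
    have h := reduce (N := N) (m := m) (t := m - 1) (k := j + m) (r := j + 1) (by omega) rfl (by omega) (by omega) H H1
    rw [expFaces, h2, h3, hq, ← h]; rfl
  have hKr : 0 < (Kint j (√(j * m / N))⁻¹).toReal := ENNReal.toReal_pos hKpos.ne' hKtop
  rw [e1, e2]
  have hc : (0:ℝ) < 2 ^ m * ((N + m).choose m) := by
    have : 0 < (N + m).choose m := Nat.choose_pos (by omega)
    positivity
  rw [mul_div_mul_left _ _ hc.ne']
  by_cases hq0 : q = 0
  · rw [hq0]; simpa using hKr
  have hmain := main_ineq hj hjN hm H1 hq0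
  have hqt : q ≠ ⊤ := measure_ne_top _ _
  rw [div_lt_iff₀ (ENNReal.toReal_pos hq0 hqt), ← ENNReal.toReal_mul]
  exact (ENNReal.toReal_lt_toReal (measure_ne_top _ _) (ENNReal.mul_ne_top hKtop hqt)).2 hmain
end
end

section
/- (Brascamp–Lieb inequality, Ball's form.) Let (u_i)_{i=1}^m be unit vectors in ℝ^n and (c_i)_{i=1}^m positive real numbers such that ∑_{i=1}^m c_i · (u_i ⊗ u_i) = I_n, the identity operator on ℝ^n. For each i let f_i : ℝ → [0,∞) be integrable. Then ∫_{ℝ^n} ∏_{i=1}^m f_i(⟨u_i, x⟩)^{c_i} dx ≤ ∏_{i=1}^m (∫_ℝ f_i)^{c_i}. -/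
open MeasureTheory Real RealInnerProductSpace

noncomputable section

/-- Gaussian quantile function. -/
lemma bl_quantile : ∃ Q : ℝ → ℝ, StrictMonoOn Q (Set.Ioo 0 1) ∧
    ∀ p ∈ Set.Ioo (0:ℝ) 1, HasDerivAt Q (rexp (-π * (Q p) ^ 2))⁻¹ p := by
  have hcont : Continuous fun s : ℝ => rexp (-π * s ^ 2) := by fun_prop
  have hint : Integrable fun s : ℝ => rexp (-π * s ^ 2) := integrable_exp_neg_mul_sq pi_pos
  set G : ℝ → ℝ := fun t => 1 / 2 + ∫ s in (0:ℝ)..t, rexp (-π * s ^ 2) with hG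
  have hd : ∀ t, HasDerivAt G (rexp (-π * t ^ 2)) t := fun t =>
    (intervalIntegral.integral_hasDerivAt_right (hcont.intervalIntegrable _ _)
      (hcont.stronglyMeasurableAtFilter _ _) hcont.continuousAt).const_add _
  have hmono : StrictMono G := strictMono_of_hasDerivAt_pos hd (fun t => exp_pos _)
  have hGc : Continuous G := continuous_iff_continuousAt.2 fun t => (hd t).continuousAt
  have htop : Filter.Tendsto G Filter.atTop (nhds 1) := by
    have := (intervalIntegral_tendsto_integral_Ioi 0 hint.integrableOn Filter.tendsto_id).const_add
      (1 / 2 : ℝ)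
    rw [integral_gaussian_Ioi, div_self pi_pos.ne'] at this
    have h2 : (1 / 2 + √1 / 2 : ℝ) = 1 := by rw [Real.sqrt_one]; norm_num
    rw [h2] at this
    exact this
  have hneg : ∀ t, G (-t) = 1 - G t := by
    intro t
    have := intervalIntegral.integral_comp_neg (a := 0) (b := t) (fun s : ℝ => rexp (-π * s ^ 2))
    simp only [neg_sq, neg_zero] at this
    simp only [hG]
    rw [this, intervalIntegral.integral_symm (-t) 0]
    ring
  have hsurj : ∀ p ∈ Set.Ioo (0:ℝ) 1, ∃ t, G t = p := by
    intro p hp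
    obtain ⟨b, hb⟩ := (htop.eventually (lt_mem_nhds hp.2)).exists
    obtain ⟨a, ha⟩ := (htop.eventually (lt_mem_nhds (show 1 - p < 1 by linarith [hp.1]))).exists
    have h1 : G (-a) < p := by rw [hneg]; linarith
    exact mem_range_of_exists_le_of_exists_ge hGc ⟨_, h1.le⟩ ⟨_, hb.le⟩
  have hrange : ∀ t, G t ∈ Set.Ioo (0:ℝ) 1 := by
    have h1 : ∀ t, G t < 1 := fun t =>
      (hmono (lt_add_one t)).trans_le (hmono.monotone.ge_of_tendsto htop _)
    intro t
    refine ⟨?_, h1 t⟩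
    have := h1 (-t)
    rw [hneg] at this
    linarith
  choose! Q hQ using hsurj
  have hQG : ∀ t, Q (G t) = t := fun t => hmono.injective (hQ _ (hrange t))
  have hQm : StrictMonoOn Q (Set.Ioo 0 1) := by
    intro a ha b hb hab
    rw [← hmono.lt_iff_lt, hQ a ha, hQ b hb]; exact hab
  refine ⟨Q, hQm, fun p hp => ?_⟩
  have hnh : Set.Ioo (0:ℝ) 1 ∈ nhds p := Ioo_mem_nhds hp.1 hp.2
  have hc : ContinuousAt Q p := by
    refine hQm.continuousAt_of_image_mem_nhds hnh ?_
    have : Q '' Set.Ioo 0 1 = Set.univ := by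
      ext t; simp only [Set.mem_univ, iff_true]; exact ⟨G t, hrange t, hQG t⟩
    rw [this]; exact Filter.univ_mem
  refine (hd (Q p)).of_local_left_inverse hc (exp_pos _).ne' ?_
  filter_upwards [hnh] with q hq using hQ q hq

/-- Distribution function. -/
lemma bl_cdf (f : ℝ → ℝ) (hf0 : ∀ x, 0 ≤ f x) (hf : Integrable f) (h1 : ∫ x, f x = 1) :
    ∃ F : ℝ → ℝ, Monotone F ∧ (∀ t, F t ∈ Set.Icc (0:ℝ) 1) ∧ ∀ᵐ t, f t = deriv F t := by
  refine ⟨fun t => ∫ s in Set.Iic t, f s, ?_, ?_, ?_⟩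
  · intro a b hab
    exact setIntegral_mono_set hf.integrableOn (Filter.Eventually.of_forall hf0)
      (Set.Iic_subset_Iic.2 hab).eventuallyLE
  · intro t
    refine ⟨integral_nonneg hf0, ?_⟩
    rw [← h1]
    exact setIntegral_le_integral hf (Filter.Eventually.of_forall hf0)
  · filter_upwards [LocallyIntegrable.ae_hasDerivAt_integral hf.locallyIntegrable] with t ht
    have h := (ht 0).const_add (∫ s in Set.Iic (0:ℝ), f s)
    have : (fun t => ∫ s in Set.Iic t, f s) =
        fun t => (∫ s in Set.Iic (0:ℝ), f s) + ∫ s in (0:ℝ)..t, f s := by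
      ext t
      rw [← intervalIntegral.integral_Iic_sub_Iic hf.integrableOn hf.integrableOn]
      ring
    rw [this]
    exact h.deriv.symm

/-- Transport map. -/
lemma bl_transport (F : ℝ → ℝ) (hF : Monotone F) (h01 : ∀ t, F t ∈ Set.Icc (0:ℝ) 1) :
    ∃ T : ℝ → ℝ, (∀ t, 0 < deriv F t →
        HasDerivAt T (deriv F t / rexp (-π * (T t) ^ 2)) t) ∧
      ∀ a b, 0 < deriv F a → 0 < deriv F b → a < b → T a < T b := by
  obtain ⟨Q, hQm, hQ⟩ := bl_quantile
  have hdiff : ∀ t, 0 < deriv F t → HasDerivAt F (deriv F t) t := fun t ht =>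
    (differentiableAt_of_deriv_ne_zero ht.ne').hasDerivAt
  have hlt : ∀ t, 0 < deriv F t → (∀ b, t < b → F t < F b) ∧ (∀ b, b < t → F b < F t) := by
    intro t ht
    constructor
    · intro b hb
      refine lt_of_le_of_ne (hF hb.le) fun he => ht.ne' ?_
      have h1 : HasDerivWithinAt F 0 (Set.Icc t b) t := by
        refine (hasDerivWithinAt_const t _ (F t)).congr_of_mem (fun x hx => ?_) ⟨le_rfl, hb.le⟩
        exact le_antisymm (he ▸ hF hx.2) (hF hx.1)
      exact (uniqueDiffOn_Icc hb t ⟨le_rfl, hb.le⟩).eq_deriv _ (hdiff t ht).hasDerivWithinAt h1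
    · intro b hb
      refine lt_of_le_of_ne (hF hb.le) fun he => ht.ne' ?_
      have h1 : HasDerivWithinAt F 0 (Set.Icc b t) t := by
        refine (hasDerivWithinAt_const t _ (F t)).congr_of_mem (fun x hx => ?_) ⟨hb.le, le_rfl⟩
        exact le_antisymm (hF hx.2) (he ▸ hF hx.1)
      exact (uniqueDiffOn_Icc hb t ⟨hb.le, le_rfl⟩).eq_deriv _ (hdiff t ht).hasDerivWithinAt h1
  have hmem : ∀ t, 0 < deriv F t → F t ∈ Set.Ioo (0:ℝ) 1 := fun t ht =>
    ⟨(h01 (t - 1)).1.trans_lt ((hlt t ht).2 _ (by linarith)),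
      ((hlt t ht).1 (t + 1) (by linarith)).trans_le (h01 _).2⟩
  refine ⟨fun t => Q (F t), fun t ht => ?_, fun a b ha hb hab => ?_⟩
  · have := (hQ _ (hmem t ht)).comp t (hdiff t ht)
    rw [div_eq_inv_mul]
    exact this
  · exact hQm (hmem a ha) (hmem b hb) ((hlt a ha).1 b hab)


lemma bl_sum_sq {n m : ℕ} (u : Fin m → EuclideanSpace ℝ (Fin n)) (c : Fin m → ℝ)
    (hI : ∀ x : EuclideanSpace ℝ (Fin n), ∑ i, c i • (⟪u i, x⟫ • u i) = x)
    (x : EuclideanSpace ℝ (Fin n)) : ∑ i, c i * ⟪u i, x⟫ ^ 2 = ‖x‖ ^ 2 := by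
  rw [← real_inner_self_eq_norm_sq]
  calc ∑ i, c i * ⟪u i, x⟫ ^ 2 = ⟪∑ i, c i • (⟪u i, x⟫ • u i), x⟫ := by
        rw [sum_inner]
        refine Finset.sum_congr rfl fun i _ => ?_
        rw [real_inner_smul_left, real_inner_smul_left]
        ring
    _ = ⟪x, x⟫ := by rw [hI x]

lemma bl_norm_le {n m : ℕ} (u : Fin m → EuclideanSpace ℝ (Fin n)) (c : Fin m → ℝ) (hc : ∀ i, 0 < c i)
    (hI : ∀ x : EuclideanSpace ℝ (Fin n), ∑ i, c i • (⟪u i, x⟫ • u i) = x)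
    (t : Fin m → ℝ) : ‖∑ i, (c i * t i) • u i‖ ^ 2 ≤ ∑ i, c i * t i ^ 2 := by
  set y := ∑ i, (c i * t i) • u i with hy
  have h1 : ‖y‖ ^ 2 = ∑ i, c i * t i * ⟪u i, y⟫ := by
    rw [← real_inner_self_eq_norm_sq]
    calc ⟪y, y⟫ = ⟪∑ i, (c i * t i) • u i, y⟫ := by rw [← hy]
      _ = _ := by rw [sum_inner]; simp only [real_inner_smul_left]
  have h2 := bl_sum_sq u c hI y
  have h3 : ∑ i, c i * t i * ⟪u i, y⟫ ≤ ∑ i, (c i * t i ^ 2 / 2 + c i * ⟪u i, y⟫ ^ 2 / 2) := by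
    refine Finset.sum_le_sum fun i _ => ?_
    nlinarith [mul_nonneg (hc i).le (sq_nonneg (t i - ⟪u i, y⟫))]
  rw [Finset.sum_add_distrib, ← Finset.sum_div, ← Finset.sum_div, h2] at h3
  linarith

/-- The derivative operator. -/
def blOp {n m : ℕ} (u : Fin m → EuclideanSpace ℝ (Fin n)) (a : Fin m → ℝ) :
    EuclideanSpace ℝ (Fin n) →L[ℝ] EuclideanSpace ℝ (Fin n) :=
  ∑ i, a i • (innerSL ℝ (u i)).smulRight (u i)

lemma blOp_apply {n m : ℕ} (u : Fin m → EuclideanSpace ℝ (Fin n)) (a : Fin m → ℝ)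
    (x : EuclideanSpace ℝ (Fin n)) : blOp u a x = ∑ i, (a i * ⟪u i, x⟫) • u i := by
  simp [blOp, smul_smul]

lemma bl_det {n m : ℕ} (u : Fin m → EuclideanSpace ℝ (Fin n)) (hu : ∀ i, ‖u i‖ = 1)
    (c : Fin m → ℝ) (hc : ∀ i, 0 < c i)
    (hI : ∀ x : EuclideanSpace ℝ (Fin n), ∑ i, c i • (⟪u i, x⟫ • u i) = x)
    (t : Fin m → ℝ) (ht : ∀ i, 0 < t i) :
    ∏ i, t i ^ c i ≤ (blOp u fun i => c i * t i).det := by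
  set A := blOp u fun i => c i * t i with hA
  have hsymm : (A : EuclideanSpace ℝ (Fin n) →ₗ[ℝ] EuclideanSpace ℝ (Fin n)).IsSymmetric := by
    intro x y
    simp only [ContinuousLinearMap.coe_coe, hA, blOp_apply, sum_inner, inner_sum,
      real_inner_smul_left, real_inner_smul_right]
    refine Finset.sum_congr rfl fun i _ => ?_
    rw [real_inner_comm x (u i)]
    ring
  have hn : Module.finrank ℝ (EuclideanSpace ℝ (Fin n)) = n := by simp
  have hdet := hsymm.det_eq_prod_eigenvalues hn
  set e := hsymm.eigenvectorBasis hn with he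
  change _ ≤ LinearMap.det (A : EuclideanSpace ℝ (Fin n) →ₗ[ℝ] EuclideanSpace ℝ (Fin n))
  rw [hdet]
  have hlam : ∀ j, hsymm.eigenvalues hn j = ∑ i, (c i * ⟪u i, e j⟫ ^ 2) * t i := by
    intro j
    have h1 := hsymm.apply_eigenvectorBasis hn j
    have h2 : ⟪A (e j), e j⟫ = hsymm.eigenvalues hn j := by
      change A (e j) = _ • e j at h1
      rw [h1, real_inner_smul_left, real_inner_self_eq_norm_sq, e.norm_eq_one]
      simp
    rw [← h2, hA, blOp_apply, sum_inner]
    refine Finset.sum_congr rfl fun i _ => ?_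
    rw [real_inner_smul_left]
    ring
  calc ∏ i, t i ^ c i = ∏ i, ∏ j, t i ^ (c i * ⟪u i, e j⟫ ^ 2) := by
        refine Finset.prod_congr rfl fun i _ => ?_
        rw [← Real.rpow_sum_of_pos (ht i), ← Finset.mul_sum]
        have := e.sum_sq_norm_inner_left (u i)
        simp only [Real.norm_eq_abs, sq_abs] at this
        rw [this, hu]; simp
    _ = ∏ j, ∏ i, t i ^ (c i * ⟪u i, e j⟫ ^ 2) := Finset.prod_comm
    _ ≤ ∏ j, hsymm.eigenvalues hn j := by
        refine Finset.prod_le_prod (fun j _ => Finset.prod_nonneg fun i _ =>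
          (Real.rpow_pos_of_pos (ht i) _).le) fun j _ => ?_
        rw [hlam]
        refine Real.geom_mean_le_arith_mean_weighted _ _ _
          (fun i _ => mul_nonneg (hc i).le (sq_nonneg _)) ?_ (fun i _ => (ht i).le)
        rw [bl_sum_sq u c hI, e.norm_eq_one]; simp
    _ = _ := by simp

lemma bl_core {n m : ℕ} (u : Fin m → EuclideanSpace ℝ (Fin n)) (hu : ∀ i, ‖u i‖ = 1)
    (c : Fin m → ℝ) (hc : ∀ i, 0 < c i)
    (hI : ∀ x : EuclideanSpace ℝ (Fin n), ∑ i, c i • (⟪u i, x⟫ • u i) = x)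
    (F : Fin m → ℝ → ℝ) (hF : ∀ i, Monotone (F i)) (h01 : ∀ i t, F i t ∈ Set.Icc (0:ℝ) 1) :
    ∫⁻ x : EuclideanSpace ℝ (Fin n), ENNReal.ofReal (∏ i, (deriv (F i) ⟪u i, x⟫) ^ (c i)) ≤ 1 := by
  choose T hT hTm using fun i => bl_transport (F i) (hF i) (h01 i)
  set S : Set (EuclideanSpace ℝ (Fin n)) := {x | ∀ i, 0 < deriv (F i) ⟪u i, x⟫} with hS
  have hSm : MeasurableSet S := by
    rw [hS, Set.ofPred_forall]
    refine MeasurableSet.iInter fun i => ?_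
    exact measurableSet_lt measurable_const ((measurable_deriv (F i)).comp (by fun_prop))
  set Θ : EuclideanSpace ℝ (Fin n) → EuclideanSpace ℝ (Fin n) :=
    fun x => ∑ i, (c i * T i ⟪u i, x⟫) • u i with hΘ
  set t : EuclideanSpace ℝ (Fin n) → Fin m → ℝ :=
    fun x i => deriv (F i) ⟪u i, x⟫ / rexp (-π * (T i ⟪u i, x⟫) ^ 2) with ht
  have hder : ∀ x ∈ S, HasFDerivWithinAt Θ (blOp u fun i => c i * t x i) S x := by
    intro x hx
    refine HasFDerivAt.hasFDerivWithinAt ?_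
    refine HasFDerivAt.fun_sum fun i _ => ?_
    have h1 : HasFDerivAt (fun x => ⟪u i, x⟫) (innerSL ℝ (u i)) x := (innerSL ℝ (u i)).hasFDerivAt
    have h2 := (((hT i _ (hx i)).comp_hasFDerivAt x h1).const_mul (c i)).smul_const (u i)
    refine h2.congr_fderiv ?_
    ext1 y
    simp [ht, smul_smul, mul_assoc]
  have hinj : Set.InjOn Θ S := by
    intro x hx y hy hxy
    by_contra hne
    have h0 : ∑ i, c i * ((T i ⟪u i, x⟫ - T i ⟪u i, y⟫) * (⟪u i, x⟫ - ⟪u i, y⟫)) = 0 := by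
      have : ⟪Θ x - Θ y, x - y⟫ = 0 := by rw [hxy, sub_self, inner_zero_left]
      rw [← this, hΘ]
      simp only [← Finset.sum_sub_distrib, sum_inner, ← sub_smul, real_inner_smul_left,
        inner_sub_right]
      refine Finset.sum_congr rfl fun i _ => ?_
      ring
    have hpos : ∀ i, ⟪u i, x⟫ ≠ ⟪u i, y⟫ →
        0 < (T i ⟪u i, x⟫ - T i ⟪u i, y⟫) * (⟪u i, x⟫ - ⟪u i, y⟫) := by
      intro i hi
      rcases lt_or_gt_of_ne hi with h | h
      · exact mul_pos_of_neg_of_neg (sub_neg.2 (hTm i _ _ (hx i) (hy i) h)) (sub_neg.2 h)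
      · exact mul_pos (sub_pos.2 (hTm i _ _ (hy i) (hx i) h)) (sub_pos.2 h)
    have hall : ∀ i, ⟪u i, x⟫ = ⟪u i, y⟫ := by
      have h1 := (Finset.sum_eq_zero_iff_of_nonneg (fun i _ => ?_)).1 h0
      · intro i
        by_contra hi
        exact (mul_pos (hc i) (hpos i hi)).ne' (h1 i (Finset.mem_univ i))
      · by_cases hi : ⟪u i, x⟫ = ⟪u i, y⟫
        · simp [hi]
        · exact (mul_pos (hc i) (hpos i hi)).le
    apply hne
    rw [← hI x, ← hI y]
    simp only [hall]
  have hgauss : ∫⁻ y : EuclideanSpace ℝ (Fin n), ENNReal.ofReal (rexp (-π * ‖y‖ ^ 2)) = 1 := by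
    have h1 := GaussianFourier.integral_rexp_neg_mul_sq_norm (V := EuclideanSpace ℝ (Fin n)) pi_pos
    rw [div_self pi_pos.ne', Real.one_rpow] at h1
    rw [← ofReal_integral_eq_lintegral_ofReal, h1, ENNReal.ofReal_one]
    · by_contra h
      rw [integral_undef h] at h1
      exact zero_ne_one h1
    · exact Filter.Eventually.of_forall fun y => (exp_pos _).le
  calc ∫⁻ x : EuclideanSpace ℝ (Fin n), ENNReal.ofReal (∏ i, (deriv (F i) ⟪u i, x⟫) ^ (c i))
      = ∫⁻ x in S, ENNReal.ofReal (∏ i, (deriv (F i) ⟪u i, x⟫) ^ (c i)) := by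
        symm
        refine setLIntegral_eq_of_support_subset ?_
        intro x hx i
        have h0 : 0 ≤ deriv (F i) ⟪u i, x⟫ := (hF i).deriv_nonneg
        refine lt_of_le_of_ne h0 fun h => hx ?_
        change ENNReal.ofReal (∏ i, (deriv (F i) ⟪u i, x⟫) ^ (c i)) = 0
        rw [Finset.prod_eq_zero (Finset.mem_univ i), ENNReal.ofReal_zero]
        rw [← h, Real.zero_rpow (hc i).ne']
    _ ≤ ∫⁻ x in S, ENNReal.ofReal |(blOp u fun i => c i * t x i).det| *
          ENNReal.ofReal (rexp (-π * ‖Θ x‖ ^ 2)) := by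
        refine setLIntegral_mono' hSm fun x hx => ?_
        rw [← ENNReal.ofReal_mul (abs_nonneg _)]
        refine ENNReal.ofReal_le_ofReal ?_
        have htp : ∀ i, 0 < t x i := fun i => div_pos (hx i) (exp_pos _)
        have h1 : ∏ i, (deriv (F i) ⟪u i, x⟫) ^ (c i) =
            (∏ i, t x i ^ c i) * rexp (-π * ∑ i, c i * (T i ⟪u i, x⟫) ^ 2) := by
          rw [Finset.mul_sum, Real.exp_sum, ← Finset.prod_mul_distrib]
          refine Finset.prod_congr rfl fun i _ => ?_
          have h2 : deriv (F i) ⟪u i, x⟫ = t x i * rexp (-π * (T i ⟪u i, x⟫) ^ 2) :=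
            (div_mul_cancel₀ _ (exp_pos _).ne').symm
          rw [h2, Real.mul_rpow (htp i).le (exp_pos _).le, ← Real.exp_mul]
          congr 2
          ring
        rw [h1]
        refine mul_le_mul ((bl_det u hu c hc hI _ htp).trans (le_abs_self _)) ?_ (exp_pos _).le
          (abs_nonneg _)
        refine Real.exp_le_exp.2 ?_
        have := bl_norm_le u c hc hI fun i => T i ⟪u i, x⟫
        nlinarith [pi_pos]
    _ = ∫⁻ y in Θ '' S, ENNReal.ofReal (rexp (-π * ‖y‖ ^ 2)) :=
        (lintegral_image_eq_lintegral_abs_det_fderiv_mul volume hSm hder hinj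
          (fun y => ENNReal.ofReal (rexp (-π * ‖y‖ ^ 2)))).symm
    _ ≤ ∫⁻ y, ENNReal.ofReal (rexp (-π * ‖y‖ ^ 2)) := setLIntegral_le_lintegral _ _
    _ = 1 := hgauss

lemma bl_ae {n : ℕ} (u : EuclideanSpace ℝ (Fin n)) (hu : ‖u‖ = 1) (p : ℝ → Prop) (hp : ∀ᵐ t, p t) :
    ∀ᵐ x : EuclideanSpace ℝ (Fin n), p ⟪u, x⟫ := by
  obtain ⟨s, hs, hsm, hs0⟩ := exists_measurable_superset_of_null (ae_iff.1 hp)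
  have hsurj : Function.Surjective (innerSL ℝ u : EuclideanSpace ℝ (Fin n) →ₗ[ℝ] ℝ) := by
    intro t
    refine ⟨t • u, ?_⟩
    simp [real_inner_smul_right, real_inner_self_eq_norm_sq, hu]
  have h := (ae_comp_linearMap_mem_iff (innerSL ℝ u : EuclideanSpace ℝ (Fin n) →ₗ[ℝ] ℝ)
    (volume : Measure (EuclideanSpace ℝ (Fin n))) (volume : Measure ℝ) hsurj hsm.compl).2
    (by rw [ae_iff]; simpa using hs0)
  filter_upwards [h] with x hx
  by_contra hpx
  exact hx (hs hpx)

lemma bl_normalized {n m : ℕ} (u : Fin m → EuclideanSpace ℝ (Fin n)) (hu : ∀ i, ‖u i‖ = 1)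
    (c : Fin m → ℝ) (hc : ∀ i, 0 < c i)
    (hI : ∀ x : EuclideanSpace ℝ (Fin n), ∑ i, c i • (⟪u i, x⟫ • u i) = x)
    (f : Fin m → ℝ → ℝ) (hf0 : ∀ i, ∀ x : ℝ, 0 ≤ f i x) (hfint : ∀ i, Integrable (f i))
    (h1 : ∀ i, ∫ y, f i y = 1) :
    ∫ x : EuclideanSpace ℝ (Fin n), ∏ i, (f i ⟪u i, x⟫) ^ (c i) ≤ 1 := by
  by_cases hint : Integrable fun x : EuclideanSpace ℝ (Fin n) => ∏ i, (f i ⟪u i, x⟫) ^ (c i)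
  swap
  · rw [integral_undef hint]; exact zero_le_one
  choose F hF h01 hae using fun i => bl_cdf (f i) (hf0 i) (hfint i) (h1 i)
  have h := bl_core u hu c hc hI F hF h01
  have hae' : ∀ᵐ x : EuclideanSpace ℝ (Fin n), ∀ i, f i ⟪u i, x⟫ = deriv (F i) ⟪u i, x⟫ :=
    ae_all_iff.2 fun i => bl_ae (u i) (hu i) _ (hae i)
  rw [← ENNReal.ofReal_le_one, ofReal_integral_eq_lintegral_ofReal hint]
  · refine le_trans (le_of_eq (lintegral_congr_ae ?_)) h
    filter_upwards [hae'] with x hx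
    simp only [hx]
  · exact Filter.Eventually.of_forall fun x =>
      Finset.prod_nonneg fun i _ => Real.rpow_nonneg (hf0 i _) _

/-- Brascamp–Lieb inequality, Ball's form: if `(uᵢ)` are unit vectors in `ℝⁿ`
and `cᵢ > 0` with `∑ cᵢ uᵢ ⊗ uᵢ = Iₙ`, then for integrable `fᵢ : ℝ → [0,∞)`,
`∫_{ℝⁿ} ∏ᵢ fᵢ(⟨uᵢ,x⟩)^{cᵢ} dx ≤ ∏ᵢ (∫_ℝ fᵢ)^{cᵢ}`. -/
theorem brascamp_lieb_ball (n m : ℕ)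
    (u : Fin m → EuclideanSpace ℝ (Fin n)) (hu : ∀ i, ‖u i‖ = 1)
    (c : Fin m → ℝ) (hc : ∀ i, 0 < c i)
    (hI : ∀ x : EuclideanSpace ℝ (Fin n), ∑ i, c i • (⟪u i, x⟫ • u i) = x)
    (f : Fin m → ℝ → ℝ) (hf0 : ∀ i, ∀ x : ℝ, 0 ≤ f i x) (hfint : ∀ i, Integrable (f i)) :
    ∫ x : EuclideanSpace ℝ (Fin n), ∏ i, (f i ⟪u i, x⟫) ^ (c i) ≤
      ∏ i, (∫ y : ℝ, f i y) ^ (c i) := by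
  by_cases hz : ∃ i, ∫ y : ℝ, f i y = 0
  · obtain ⟨i, hi⟩ := hz
    have h0 : ∀ᵐ t, f i t = 0 :=
      (integral_eq_zero_iff_of_nonneg (hf0 i) (hfint i)).1 hi
    have h1 : ∫ x : EuclideanSpace ℝ (Fin n), ∏ i, (f i ⟪u i, x⟫) ^ (c i) = 0 := by
      refine integral_eq_zero_of_ae ?_
      filter_upwards [bl_ae (u i) (hu i) _ h0] with x hx
      exact Finset.prod_eq_zero (Finset.mem_univ i) (by rw [hx, Real.zero_rpow (hc i).ne'])
    rw [h1]
    exact Finset.prod_nonneg fun i _ => Real.rpow_nonneg (integral_nonneg (hf0 i)) _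
  · push Not at hz
    have hpos : ∀ i, 0 < ∫ y : ℝ, f i y := fun i =>
      lt_of_le_of_ne (integral_nonneg (hf0 i)) (hz i).symm
    have h := bl_normalized u hu c hc hI (fun i y => f i y / ∫ y : ℝ, f i y)
      (fun i y => div_nonneg (hf0 i y) (hpos i).le) (fun i => (hfint i).div_const _)
      (fun i => by rw [integral_div, div_self (hz i)])
    have hP : 0 < ∏ i, (∫ y : ℝ, f i y) ^ (c i) :=
      Finset.prod_pos fun i _ => Real.rpow_pos_of_pos (hpos i) _
    simp only [Real.div_rpow (hf0 _ _) (hpos _).le, Finset.prod_div_distrib, integral_div] at h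
    exact (div_le_one hP).1 h
end
end
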